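/- arXiv:1202.4513 — 2 statements merged into one kernel-verified Lean document; each statement's English description precedes it below -/
import Mathlib

section
/- Let E be a finite-dimensional real inner product space, let C_E ⊆ E be a homogeneous self-dual cone, and let u_E be an interior point of C_E. Let E₂ be the real vector space of self-adjoint (Hermitian) 2×2 complex matrices, with inner product ⟨v,w⟩ = Re(trace(v·w)), with cone C₂ of positive semidefinite matrices, and with the identity matrix I as distinguished interior point (so (E₂, C₂) is a homogeneous self-dual cone, the qubit). Suppose there exist a finite-dimensional real inner product space V, a bilinear map β : E × E₂ → V whose image spans V and which factors the inner products, i.e. ⟨β(a,v), β(b,w)⟩ = ⟨a,b⟩·⟨v,w⟩ for all a,b ∈ E and v,w ∈ E₂, and a homogeneous self-dual cone C_V ⊆ V such that: β(x,y) ∈ C_V whenever x ∈ C_E and y ∈ C₂; β(u_E, I) lies in the interior of C_V; for every linear bijection g : E → E with g(C_E) = C_E there is a linear bijection G : V → V with G(C_V) = C_V and G(β(a,v)) = β(g a, v) for all a ∈ E, v ∈ E₂; and symmetrically, for every linear bijection h : E₂ → E₂ with h(C₂) = C₂ there is a linear bijection H : V → V with H(C_V) = C_V and H(β(a,v)) =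 β(a, h v) for all a ∈ E, v ∈ E₂. Then there exist a finite-dimensional complex C*-algebra A and a real-linear bijection φ : E → selfAdjoint(A) such that φ(u_E) = 1 and φ(C_E) equals the cone of positive self-adjoint elements of A; in other words, (E, C_E, u_E) is order-isomorphic to the self-adjoint part of a finite-dimensional complex C*-algebra (a direct sum of complex matrix algebras). -/
open scoped RealInnerProductSpace ComplexOrder

noncomputable section

/-- The observables of a qubit: self-adjoint (Hermitian) `2 × 2` complex matrices. -/
abbrev QubitObservables := selfAdjoint (Matrix (Fin 2) (Fin 2) ℂ)

/-- The cone of the qubit: positive semidefinite self-adjoint `2 × 2` complex matrices. -/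
def qubitCone : Set QubitObservables :=
  {v : QubitObservables | (v : Matrix (Fin 2) (Fin 2) ℂ).PosSemidef}


set_option linter.unusedSectionVars false

namespace QK

open Filter Topology

section Cone

variable {V : Type*} [NormedAddCommGroup V] [InnerProductSpace ℝ V] [FiniteDimensional ℝ V]
  {C : Set V}

/-- self-duality -/
def SD (C : Set V) : Prop := C = {y : V | ∀ x ∈ C, 0 ≤ ⟪x, y⟫}

lemma SD.mem (h : SD C) {y : V} : y ∈ C ↔ ∀ x ∈ C, 0 ≤ ⟪x, y⟫ := by
  constructor
  · intro hy
    rw [h] at hy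
    exact hy
  · intro hy
    rw [h]
    exact hy

lemma SD.nonneg (h : SD C) {x y : V} (hx : x ∈ C) (hy : y ∈ C) : 0 ≤ ⟪x, y⟫ := h.mem.1 hy x hx

lemma SD.zero (h : SD C) : (0 : V) ∈ C := h.mem.2 (by simp)

lemma SD.add (h : SD C) {x y : V} (hx : x ∈ C) (hy : y ∈ C) : x + y ∈ C :=
  h.mem.2 fun z hz => by
    rw [inner_add_right]; exact add_nonneg (h.nonneg hz hx) (h.nonneg hz hy)

lemma SD.smul (h : SD C) {c : ℝ} (hc : 0 ≤ c) {x : V} (hx : x ∈ C) : c • x ∈ C :=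
  h.mem.2 fun z hz => by
    rw [inner_smul_right]; exact mul_nonneg hc (h.nonneg hz hx)

lemma SD.closed (h : SD C) : IsClosed C := by
  have : C = ⋂ x ∈ C, {y : V | 0 ≤ ⟪x, y⟫} := by
    conv_lhs => rw [h]
    ext y; simp
  rw [this]
  exact isClosed_biInter fun x _ => isClosed_le continuous_const (by fun_prop)

lemma SD.interior_of (h : SD C) {x : V} {δ : ℝ} (hδ : 0 < δ) (hx : ∀ y ∈ C, δ * ‖y‖ ≤ ⟪x, y⟫) :
    x ∈ interior C := by
  rw [mem_interior_iff_mem_nhds, Metric.mem_nhds_iff]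
  refine ⟨δ, hδ, fun z hz => h.mem.2 fun y hy => ?_⟩
  have h1 := hx y hy
  have h2 : |⟪y, z - x⟫| ≤ ‖y‖ * ‖z - x‖ := abs_real_inner_le_norm _ _
  have h3 : ‖z - x‖ < δ := by simpa [dist_eq_norm] using hz
  have h4 : ⟪y, z⟫ = ⟪x, y⟫ + ⟪y, z - x⟫ := by
    rw [inner_sub_right, real_inner_comm x y]; ring
  have h5 : ‖y‖ * ‖z - x‖ ≤ ‖y‖ * δ := by gcongr
  have := neg_abs_le ⟪y, z - x⟫
  rw [h4]; linarith

lemma SD.of_interior (h : SD C) {x : V} (hx : x ∈ interior C) :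
    ∃ δ : ℝ, 0 < δ ∧ (∀ z, ‖z‖ ≤ δ → x + z ∈ C) ∧ ∀ y ∈ C, δ * ‖y‖ ≤ ⟪x, y⟫ := by
  rw [mem_interior_iff_mem_nhds, Metric.mem_nhds_iff] at hx
  obtain ⟨ε, hε, hb⟩ := hx
  have key : ∀ z, ‖z‖ ≤ ε / 2 → x + z ∈ C := fun z hz => hb (by
    simp [dist_eq_norm]; linarith)
  refine ⟨ε / 2, by linarith, key, fun y hy => ?_⟩
  rcases eq_or_ne y 0 with rfl | hy0
  · simp
  have hn : 0 < ‖y‖ := norm_pos_iff.2 hy0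
  have h1 := h.nonneg (key (-((ε / 2) / ‖y‖) • y) (by
    rw [norm_smul, Real.norm_eq_abs, abs_neg, abs_of_pos (by positivity)]
    field_simp; exact le_refl _)) hy
  rw [inner_add_left, inner_smul_left, real_inner_self_eq_norm_sq] at h1
  simp only [conj_trivial] at h1
  have : -(ε / 2 / ‖y‖) * ‖y‖ ^ 2 = - (ε / 2 * ‖y‖) := by field_simp
  linarith

lemma SD.pos (h : SD C) {x y : V} (hx : x ∈ interior C) (hy : y ∈ C) (h0 : y ≠ 0) : 0 < ⟪x, y⟫ := by
  obtain ⟨δ, hδ, -, h2⟩ := h.of_interior hx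
  have := norm_pos_iff.2 h0
  exact lt_of_lt_of_le (by positivity) (h2 y hy)

/-- a boundary point is orthogonal to a unit vector of the cone -/
lemma SD.boundary (h : SD C) [Nontrivial V] {x : V} (hx : x ∈ C) (hi : x ∉ interior C) :
    ∃ y ∈ C, y ≠ 0 ∧ ⟪x, y⟫ = 0 := by
  by_contra hcon
  push Not at hcon
  have hcomp : IsCompact (C ∩ Metric.sphere (0 : V) 1) :=
    (isCompact_sphere (0 : V) 1).inter_left h.closed
  rcases (C ∩ Metric.sphere (0 : V) 1).eq_empty_or_nonempty with he | hne
  · apply hi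
    apply h.interior_of one_pos
    intro y hy
    have : y = 0 := by
      by_contra h0
      have : ‖y‖⁻¹ • y ∈ C ∩ Metric.sphere (0 : V) 1 :=
        ⟨h.smul (by positivity) hy, by simp [norm_smul, h0]⟩
      rw [he] at this; exact this
    simp [this]
  · obtain ⟨y0, hy0, hmin⟩ := hcomp.exists_isMinOn hne
      (f := fun y => ⟪x, y⟫) (by fun_prop)
    have hy0n : y0 ≠ 0 := by rintro rfl; simpa using hy0.2
    have hpos : 0 < ⟪x, y0⟫ := lt_of_le_of_ne (h.nonneg hx hy0.1) (Ne.symm (hcon y0 hy0.1 hy0n))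
    apply hi
    apply h.interior_of hpos
    intro y hy
    rcases eq_or_ne y 0 with rfl | h0
    · simp
    have hn : 0 < ‖y‖ := norm_pos_iff.2 h0
    have h1 := hmin (⟨h.smul (by positivity) hy, by simp [norm_smul, h0]⟩ :
      ‖y‖⁻¹ • y ∈ C ∩ Metric.sphere (0 : V) 1)
    simp only [Set.mem_ofPred_eq, inner_smul_right] at h1
    calc ⟪x, y0⟫ * ‖y‖ ≤ (‖y‖⁻¹ * ⟪x, y⟫) * ‖y‖ := by gcongr
      _ = ⟪x, y⟫ := by field_simp

/-- Lyapunov-like maps : the Lie algebra of the automorphism group of the cone. -/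
def Lyap (C : Set V) (X : V →L[ℝ] V) : Prop := ∀ x ∈ C, ∀ y ∈ C, ⟪x, y⟫ = 0 → ⟪X x, y⟫ = 0

lemma Lyap.add {X Y : V →L[ℝ] V} (hX : Lyap C X) (hY : Lyap C Y) : Lyap C (X + Y) :=
  fun x hx y hy h => by simp [inner_add_left, hX x hx y hy h, hY x hx y hy h]

lemma Lyap.smul {X : V →L[ℝ] V} (c : ℝ) (hX : Lyap C X) : Lyap C (c • X) :=
  fun x hx y hy h => by simp [inner_smul_left, hX x hx y hy h]

lemma Lyap.neg {X : V →L[ℝ] V} (hX : Lyap C X) : Lyap C (-X) := by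
  simpa using hX.smul (-1)

lemma Lyap.sub {X Y : V →L[ℝ] V} (hX : Lyap C X) (hY : Lyap C Y) : Lyap C (X - Y) := by
  simpa [sub_eq_add_neg] using hX.add hY.neg

lemma Lyap.adj {X : V →L[ℝ] V} (hX : Lyap C X) : Lyap C (ContinuousLinearMap.adjoint X) :=
  fun x hx y hy h => by
    rw [ContinuousLinearMap.adjoint_inner_left, real_inner_comm]
    exact hX y hy x hx (by rwa [real_inner_comm])

lemma hasDerivAt_exp_apply (X : V →L[ℝ] V) (x : V) (t : ℝ) :
    HasDerivAt (fun s : ℝ => (NormedSpace.exp (s • X)) x) (X (NormedSpace.exp (t • X) x)) t := by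
  have := (hasDerivAt_exp_smul_const' (𝕂 := ℝ) X t).clm_apply (hasDerivAt_const t x)
  simpa using this

/-- exponentials of Lyapunov-like maps preserve the cone -/
lemma Lyap.exp_mem (h : SD C) {u : V} (hu : u ∈ interior C) {X : V →L[ℝ] V} (hX : Lyap C X)
    {x : V} (hx : x ∈ C) : NormedSpace.exp X x ∈ C := by
  rcases subsingleton_or_nontrivial V with hs | hs
  · rw [Subsingleton.elim (NormedSpace.exp X x) x]; exact hx
  obtain ⟨δ, hδ, h1, h2⟩ := h.of_interior hu
  set c : ℝ := ‖X u‖ / δ + 1 with hc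
  have hcu : ∀ y ∈ C, y ≠ 0 → 0 < ⟪c • u - X u, y⟫ := by
    intro y hy h0
    have hn : 0 < ‖y‖ := norm_pos_iff.2 h0
    rw [inner_sub_left, inner_smul_left]
    have h3 := h2 y hy
    have h4 := real_inner_le_norm (X u) y
    have h5 : ‖X u‖ / δ * (δ * ‖y‖) ≤ ‖X u‖ / δ * ⟪u, y⟫ := by gcongr
    have h6 : ‖X u‖ / δ * (δ * ‖y‖) = ‖X u‖ * ‖y‖ := by field_simp
    have h7 : 0 < δ * ‖y‖ := by positivity
    simp only [conj_trivial, hc]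
    rw [add_mul]; linarith
  -- perturbed curve
  have key : ∀ ε : ℝ, 0 < ε → ∀ t : ℝ, 0 ≤ t →
      NormedSpace.exp (t • X) x + (ε * Real.exp (c * t)) • u ∈ interior C := by
    intro ε hε
    set z : ℝ → V := fun t => NormedSpace.exp (t • X) x + (ε * Real.exp (c * t)) • u with hz
    have hzd : ∀ t, HasDerivAt z (X (NormedSpace.exp (t • X) x) + (ε * (Real.exp (c * t) * c)) • u) t := by
      intro t
      refine (hasDerivAt_exp_apply X x t).add ?_
      refine HasDerivAt.smul_const ?_ u
      refine HasDerivAt.const_mul ε ?_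
      have := ((hasDerivAt_id t).const_mul c).exp
      simpa using this
    have hzc : Continuous z := continuous_iff_continuousAt.2 fun t => (hzd t).continuousAt
    by_contra hcon
    push Not at hcon
    set S : Set ℝ := {t | 0 ≤ t ∧ z t ∉ interior C} with hS
    have hSc : IsClosed S := by
      have : S = Set.Ici 0 ∩ z ⁻¹' (interior C)ᶜ := by ext; simp [hS]
      rw [this]
      exact isClosed_Ici.inter (isOpen_interior.isClosed_compl.preimage hzc)
    have hSne : S.Nonempty := by
      obtain ⟨t, ht, h3⟩ := hcon
      exact ⟨t, ht, h3⟩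
    have hSb : BddBelow S := ⟨0, fun t ht => ht.1⟩
    set t0 := sInf S
    have ht0 : t0 ∈ S := hSc.csInf_mem hSne hSb
    have hz0 : z 0 ∈ interior C := by
      apply h.interior_of (δ := ε * δ) (by positivity)
      intro y hy
      have := h2 y hy
      have h3 := h.nonneg hx hy
      simp only [hz, zero_smul, NormedSpace.exp_zero, mul_zero, Real.exp_zero, mul_one,
        inner_add_left, inner_smul_left, conj_trivial, one_apply_eq_self]
      nlinarith
    have htpos : 0 < t0 := lt_of_le_of_ne ht0.1 (fun h => ht0.2 (h ▸ hz0))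
    have hlt : ∀ t, 0 ≤ t → t < t0 → z t ∈ interior C := by
      intro t ht htt
      by_contra h3
      exact absurd (csInf_le hSb (⟨ht, h3⟩ : t ∈ S)) (not_le.2 htt)
    have hev : ∀ᶠ t in 𝓝[<] t0, z t ∈ interior C := by
      filter_upwards [Ioo_mem_nhdsLT htpos] with t ht using hlt t ht.1.le ht.2
    have hmem : z t0 ∈ C := by
      refine h.closed.mem_of_tendsto ((hzc.tendsto t0).mono_left nhdsWithin_le_nhds :
        Tendsto z (𝓝[<] t0) (𝓝 (z t0))) ?_
      filter_upwards [hev] with t ht using interior_subset ht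
    obtain ⟨y, hy, hy0, hzy⟩ := h.boundary hmem ht0.2
    have hfd : HasDerivAt (fun t => ⟪z t, y⟫)
        ⟪X (NormedSpace.exp (t0 • X) x) + (ε * (Real.exp (c * t0) * c)) • u, y⟫ t0 := by
      have := (hzd t0).inner ℝ (hasDerivAt_const t0 y)
      simpa using this
    have hXz := hX _ hmem y hy hzy
    have hval : ⟪X (NormedSpace.exp (t0 • X) x) + (ε * (Real.exp (c * t0) * c)) • u, y⟫ =
        ε * Real.exp (c * t0) * ⟪c • u - X u, y⟫ := by
      simp only [hz, map_add, map_smul, inner_add_left, inner_smul_left, inner_sub_left,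
        conj_trivial] at hXz ⊢
      linear_combination hXz
    rw [hval] at hfd
    have hp : 0 < ε * Real.exp (c * t0) * ⟪c • u - X u, y⟫ := by
      have := hcu y hy hy0
      positivity
    have hsl := (hasDerivAt_iff_tendsto_slope.1 hfd)
    have hsl' := hsl.mono_left (nhdsWithin_mono t0 (fun t (ht : t < t0) => ne_of_lt ht) :
      𝓝[<] t0 ≤ 𝓝[≠] t0)
    have hev2 := hsl'.eventually (lt_mem_nhds hp)
    obtain ⟨t, ⟨h5, h6⟩, h7⟩ := ((hev2.and hev).and self_mem_nhdsWithin).exists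
    have h8 := h.nonneg (interior_subset h6) hy
    rw [slope_def_field, hzy] at h5
    have h9 : (⟪z t, y⟫ - 0) / (t - t0) ≤ 0 :=
      div_nonpos_of_nonneg_of_nonpos (by linarith) (by have : t < t0 := h7; linarith)
    linarith
  -- limit
  have hlim : Tendsto (fun ε : ℝ => NormedSpace.exp X x + (ε * Real.exp c) • u) (𝓝[>] 0)
      (𝓝 (NormedSpace.exp X x)) := by
    have : Continuous (fun ε : ℝ => NormedSpace.exp X x + (ε * Real.exp c) • u) := by fun_prop
    have := this.tendsto 0
    simp only [zero_mul, zero_smul, add_zero] at this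
    exact this.mono_left nhdsWithin_le_nhds
  refine h.closed.mem_of_tendsto hlim ?_
  filter_upwards [self_mem_nhdsWithin] with ε hε
  have := key ε hε 1 zero_le_one
  simp only [one_smul, mul_one] at this
  exact interior_subset this

end Cone

end QK

namespace QK

open Filter Topology

section Aut

variable {V : Type*} [NormedAddCommGroup V] [InnerProductSpace ℝ V] [FiniteDimensional ℝ V]
  {C : Set V}

/-- automorphism (with its inverse) of the cone -/
def IsAut (C : Set V) (g g' : V →L[ℝ] V) : Prop :=
  g * g' = 1 ∧ g' * g = 1 ∧ (∀ x ∈ C, g x ∈ C) ∧ ∀ x ∈ C, g' x ∈ C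

lemma IsAut.mul {g g' h h' : V →L[ℝ] V} (hg : IsAut C g g') (hh : IsAut C h h') :
    IsAut C (g * h) (h' * g') := by
  refine ⟨?_, ?_, fun x hx => hg.2.2.1 _ (hh.2.2.1 x hx), fun x hx => hh.2.2.2 _ (hg.2.2.2 x hx)⟩
  · rw [mul_assoc, ← mul_assoc h, hh.1, one_mul, hg.1]
  · rw [mul_assoc, ← mul_assoc g', hg.2.1, one_mul, hh.2.1]

lemma IsAut.symm {g g' : V →L[ℝ] V} (hg : IsAut C g g') : IsAut C g' g :=
  ⟨hg.2.1, hg.1, hg.2.2.2, hg.2.2.1⟩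

lemma exp_mul_neg (X : V →L[ℝ] V) : NormedSpace.exp X * NormedSpace.exp (-X) = 1 := by
  let _ : NormedAlgebra ℚ (V →L[ℝ] V) := NormedAlgebra.restrictScalars ℚ ℝ _
  rw [← NormedSpace.exp_add_of_commute (Commute.neg_right (Commute.refl X))]
  simp

lemma Lyap.aut (h : SD C) {u : V} (hu : u ∈ interior C) {X : V →L[ℝ] V} (hX : Lyap C X) :
    IsAut C (NormedSpace.exp X) (NormedSpace.exp (-X)) := by
  refine ⟨exp_mul_neg X, by simpa using exp_mul_neg (-X), fun x hx => hX.exp_mem h hu hx,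
    fun x hx => hX.neg.exp_mem h hu hx⟩

lemma IsAut.ofEquiv (g : V ≃ₗ[ℝ] V) (hg : g '' C = C) :
    IsAut C (LinearMap.toContinuousLinearMap g.toLinearMap)
      (LinearMap.toContinuousLinearMap g.symm.toLinearMap) := by
  refine ⟨by ext; simp, by ext; simp, fun x hx => ?_, fun x hx => ?_⟩
  · rw [← hg]; exact ⟨x, hx, rfl⟩
  · rw [← hg] at hx
    obtain ⟨y, hy, rfl⟩ := hx
    simpa using hy

lemma isClosed_isAut (h : SD C) : IsClosed {p : (V →L[ℝ] V) × (V →L[ℝ] V) | IsAut C p.1 p.2} := by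
  have : {p : (V →L[ℝ] V) × (V →L[ℝ] V) | IsAut C p.1 p.2} =
      ({p | p.1 * p.2 = 1} ∩ {p | p.2 * p.1 = 1}) ∩
        ((⋂ x ∈ C, {p | p.1 x ∈ C}) ∩ ⋂ x ∈ C, {p | p.2 x ∈ C}) := by
    ext p; simp [IsAut, and_assoc]
  rw [this]
  refine ((isClosed_eq (by fun_prop) (by fun_prop)).inter
    (isClosed_eq (by fun_prop) (by fun_prop))).inter (IsClosed.inter ?_ ?_)
  · exact isClosed_biInter fun x _ => h.closed.preimage (by fun_prop)
  · exact isClosed_biInter fun x _ => h.closed.preimage (by fun_prop)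

lemma SD.bound (h : SD C) {u : V} (hu : u ∈ interior C) :
    ∃ M : ℝ, 0 ≤ M ∧ ∀ g : V →L[ℝ] V, (∀ x ∈ C, g x ∈ C) → ‖g‖ ≤ M * ⟪u, g u⟫ := by
  obtain ⟨δ, hδ, h1, h2⟩ := h.of_interior hu
  refine ⟨δ⁻¹ * δ⁻¹, by positivity, fun g hg => ?_⟩
  have hnn : 0 ≤ ⟪u, g u⟫ := h.nonneg (interior_subset hu) (hg u (interior_subset hu))
  have key : ∀ z, ‖z‖ ≤ δ → ‖g z‖ ≤ δ⁻¹ * ⟪u, g u⟫ := by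
    intro z hz
    have a1 := h2 _ (hg _ (h1 z hz))
    have a2 := h2 _ (hg _ (h1 (-z) (by simpa using hz)))
    simp only [map_add, map_neg, inner_add_right, inner_neg_right] at a1 a2
    have a3 : ‖g u + g z - (g u + -g z)‖ ≤ ‖g u + g z‖ + ‖g u + -g z‖ := norm_sub_le _ _
    have a4 : g u + g z - (g u + -g z) = (2 : ℝ) • g z := by module
    rw [a4, norm_smul, Real.norm_eq_abs, abs_of_pos two_pos] at a3
    rw [inv_mul_eq_div, le_div_iff₀ hδ]
    nlinarith
  apply ContinuousLinearMap.opNorm_le_bound _ (by positivity)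
  intro x
  rcases eq_or_ne x 0 with rfl | hx
  · simp
  have hn : 0 < ‖x‖ := norm_pos_iff.2 hx
  have := key ((δ / ‖x‖) • x) (by
    rw [norm_smul, Real.norm_eq_abs, abs_of_pos (by positivity)]; field_simp; exact le_refl _)
  rw [map_smul, norm_smul, Real.norm_eq_abs, abs_of_pos (by positivity)] at this
  calc ‖g x‖ = (δ⁻¹ * ‖x‖) * (δ / ‖x‖ * ‖g x‖) := by field_simp
    _ ≤ (δ⁻¹ * ‖x‖) * (δ⁻¹ * ⟪u, g u⟫) := by gcongr
    _ = _ := by ring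

lemma Lyap.conj (h : SD C) {g g' X : V →L[ℝ] V} (hg : IsAut C g g') (hX : Lyap C X) :
    Lyap C (g * X * g') := by
  intro x hx y hy hxy
  have h1 : ContinuousLinearMap.adjoint g y ∈ C := h.mem.2 fun z hz => by
    rw [ContinuousLinearMap.adjoint_inner_right]; exact h.nonneg (hg.2.2.1 z hz) hy
  have h2 : ⟪g' x, ContinuousLinearMap.adjoint g y⟫ = 0 := by
    rw [ContinuousLinearMap.adjoint_inner_right]
    have : g (g' x) = x := by
      have := congrArg (fun f : V →L[ℝ] V => f x) hg.1
      simpa using this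
    rw [this, hxy]
  have h3 := hX _ (hg.2.2.2 x hx) _ h1 h2
  rw [ContinuousLinearMap.adjoint_inner_right] at h3
  simpa using h3

lemma Lyap.comm (h : SD C) {u : V} (hu : u ∈ interior C) {X Y : V →L[ℝ] V} (hX : Lyap C X)
    (hY : Lyap C Y) : Lyap C (X * Y - Y * X) := by
  intro x hx y hy hxy
  have h0 : ∀ t : ℝ, ⟪(NormedSpace.exp (t • X) * Y * NormedSpace.exp (t • (-X))) x, y⟫ = 0 := by
    intro t
    rw [smul_neg]
    exact Lyap.conj h ((hX.smul t).aut h hu) hY x hx y hy hxy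
  have hd : HasDerivAt (fun t : ℝ => NormedSpace.exp (t • X) * Y * NormedSpace.exp (t • (-X)))
      (X * Y - Y * X) 0 := by
    have := ((hasDerivAt_exp_smul_const' (𝕂 := ℝ) X 0).mul_const Y).mul
      (hasDerivAt_exp_smul_const' (𝕂 := ℝ) (-X) 0)
    have e : X * NormedSpace.exp ((0 : ℝ) • X) * Y * NormedSpace.exp ((0 : ℝ) • -X) +
        NormedSpace.exp ((0 : ℝ) • X) * Y * (-X * NormedSpace.exp ((0 : ℝ) • -X)) =
        X * Y - Y * X := by
      simp [sub_eq_add_neg]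
    rw [← e]
    exact this
  have hd2 := (hd.clm_apply (hasDerivAt_const (0 : ℝ) x)).inner ℝ (hasDerivAt_const (0 : ℝ) y)
  have hd3 : HasDerivAt (fun _ : ℝ => (0 : ℝ)) (⟪(X * Y - Y * X) x, y⟫) 0 := by
    simp only [h0] at hd2
    simpa using hd2
  exact hd3.unique (hasDerivAt_const _ _)

lemma exp_fix {X : V →L[ℝ] V} {u : V} (hu : X u = 0) : NormedSpace.exp X u = u := by
  have hd : ∀ t : ℝ, HasDerivAt (fun s : ℝ => NormedSpace.exp (s • X) u) 0 t := by
    intro t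
    have := (hasDerivAt_exp_smul_const (𝕂 := ℝ) X t).clm_apply (hasDerivAt_const t u)
    simpa [hu] using this
  have := is_const_of_deriv_eq_zero (fun t => (hd t).differentiableAt) (fun t => (hd t).deriv) 1 0
  simpa using this

lemma exp_eigen {X : V →L[ℝ] V} {b : V} {c : ℝ} (hu : X b = c • b) :
    NormedSpace.exp X b = Real.exp c • b := by
  have hd : ∀ t : ℝ, HasDerivAt (fun s : ℝ => Real.exp (-c * s) • NormedSpace.exp (s • X) b) 0 t := by
    intro t
    have h1 := (hasDerivAt_exp_smul_const (𝕂 := ℝ) X t).clm_apply (hasDerivAt_const t b)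
    have h2 := ((hasDerivAt_id t).const_mul (-c)).exp
    have := h2.smul h1
    have e : (NormedSpace.exp (t • X) * X) b = c • NormedSpace.exp (t • X) b := by
      rw [← map_smul, ← hu]; rfl
    simp only [id, mul_one, map_zero, add_zero, e] at this
    rw [smul_smul, ← add_smul, mul_neg, add_neg_cancel, zero_smul] at this
    exact this
  have := is_const_of_deriv_eq_zero (fun t => (hd t).differentiableAt) (fun t => (hd t).deriv) 1 0
  simp only [mul_one, one_smul, mul_zero, Real.exp_zero, zero_smul, NormedSpace.exp_zero,
    one_apply_eq_self] at this
  conv_rhs => rw [← this, smul_smul, ← Real.exp_add]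
  simp

lemma exp_isometry {X : V →L[ℝ] V} (hX : ∀ x, ⟪X x, x⟫ = 0) (x : V) :
    ‖NormedSpace.exp X x‖ = ‖x‖ := by
  have hd : ∀ t : ℝ, HasDerivAt (fun s : ℝ => ⟪NormedSpace.exp (s • X) x, NormedSpace.exp (s • X) x⟫) 0 t := by
    intro t
    have h1 := hasDerivAt_exp_apply X x t
    have := h1.inner ℝ h1
    rw [real_inner_comm, hX] at this
    simpa using this
  have := is_const_of_deriv_eq_zero (fun t => (hd t).differentiableAt) (fun t => (hd t).deriv) 1 0
  simp only [one_smul, zero_smul, NormedSpace.exp_zero, one_apply_eq_self,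
    real_inner_self_eq_norm_sq] at this
  exact (pow_left_inj₀ (norm_nonneg _) (norm_nonneg _) two_ne_zero).1 this

lemma Lyap.skew_kill (h : SD C) {u : V} (hu : u ∈ interior C)
    (hfix : ∀ g g' : V →L[ℝ] V, IsAut C g g' → (∀ x, ‖g x‖ = ‖x‖) → g u = u)
    {X : V →L[ℝ] V} (hX : Lyap C X) (hs : ∀ x, ⟪X x, x⟫ = 0) : X u = 0 := by
  have h0 : ∀ t : ℝ, NormedSpace.exp (t • X) u = u := fun t =>
    hfix _ _ ((hX.smul t).aut h hu) (exp_isometry (by intro x; simp [inner_smul_left, hs]))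
  have hd := hasDerivAt_exp_apply X u 0
  simp only [h0] at hd
  exact hd.unique (hasDerivAt_const _ _)

lemma Lyap.sym_eig (h : SD C) {u : V} (hu : u ∈ interior C) {S : V →L[ℝ] V} (hS : Lyap C S)
    (h0 : S u = 0) : ∀ (b : V) (c : ℝ), S b = c • b → b ≠ 0 → ¬ 0 < c := by
  obtain ⟨δ, hδ, h1, h2⟩ := h.of_interior hu
  intro b c hb hb0 hc
  have main : ∀ e : V, S e = c • e → ‖e‖ ≤ δ → e ∈ C := by
    intro e he hen
    have hlim : Tendsto (fun n : ℕ => Real.exp (-(c * n)) • u + e) atTop (𝓝 ((0 : ℝ) • u + e)) := by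
      refine Tendsto.add (Tendsto.smul_const ?_ u) tendsto_const_nhds
      refine Real.tendsto_exp_neg_atTop_nhds_zero.comp ?_
      exact tendsto_natCast_atTop_atTop.const_mul_atTop hc
    rw [zero_smul, zero_add] at hlim
    refine h.closed.mem_of_tendsto hlim (Eventually.of_forall fun n => ?_)
    have a1 := (hS.smul (n : ℝ)).exp_mem h hu (h1 e hen)
    rw [map_add, exp_fix (by simp [h0]), exp_eigen (c := n * c) (by simp [he, smul_smul])] at a1
    have a2 := h.smul (Real.exp_pos (-(c * n))).le a1
    rw [smul_add, smul_smul, ← Real.exp_add] at a2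
    simpa [mul_comm] using a2
  have hn : 0 < ‖b‖ := norm_pos_iff.2 hb0
  have b1 := main ((δ / ‖b‖) • b) (by rw [map_smul, hb, smul_comm]) (by
    rw [norm_smul, Real.norm_eq_abs, abs_of_pos (by positivity)]; field_simp; exact le_refl _)
  have b2 := main (-((δ / ‖b‖) • b)) (by rw [map_neg, map_smul, hb, smul_neg, smul_comm]) (by
    rw [norm_neg, norm_smul, Real.norm_eq_abs, abs_of_pos (by positivity)]; field_simp; exact le_refl _)
  have b3 := h.nonneg b1 b2
  rw [inner_neg_right, real_inner_self_eq_norm_sq] at b3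
  have : (δ / ‖b‖) • b = 0 := norm_eq_zero.1 (by nlinarith [norm_nonneg ((δ / ‖b‖) • b)])
  rcases smul_eq_zero.1 this with h3 | h3
  · have : 0 < δ / ‖b‖ := by positivity
    linarith
  · exact hb0 h3

lemma Lyap.sym_zero (h : SD C) {u : V} (hu : u ∈ interior C) {S : V →L[ℝ] V} (hS : Lyap C S)
    (hs : ∀ x y, ⟪S x, y⟫ = ⟪x, S y⟫) (h0 : S u = 0) : S = 0 := by
  have hsym : (S : V →ₗ[ℝ] V).IsSymmetric := hs
  have : (S : V →ₗ[ℝ] V) = 0 := by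
    refine (hsym.eigenvectorBasis rfl).toBasis.ext fun i => ?_
    have h1 := hsym.apply_eigenvectorBasis rfl i
    have hb0 : hsym.eigenvectorBasis rfl i ≠ 0 :=
      (hsym.eigenvectorBasis rfl).toBasis.ne_zero i |> fun h => by simpa using h
    have h2 := hS.sym_eig h hu h0 _ _ h1 hb0
    have h3 := hS.neg.sym_eig h hu (by simp [h0]) _ (-(hsym.eigenvalues rfl i))
      (by rw [neg_smul]; exact congrArg Neg.neg h1) hb0
    have h2' : ¬ 0 < hsym.eigenvalues rfl i := h2
    have h4 : hsym.eigenvalues rfl i = 0 := by linarith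
    rw [h4] at h1
    simpa using h1
  ext x
  exact congrArg (fun f : V →ₗ[ℝ] V => f x) this

end Aut

end QK

namespace QK

open Filter Topology

section Slice

variable {V : Type*} [NormedAddCommGroup V] [InnerProductSpace ℝ V] [FiniteDimensional ℝ V]
  {C : Set V}

lemma Lyap.of_tendsto (h : SD C) {g g' : ℕ → V →L[ℝ] V} {d : ℕ → ℝ} {X : V →L[ℝ] V}
    (hg : ∀ n, IsAut C (g n) (g' n)) (hd : ∀ n, 0 < d n) (hg1 : Tendsto g' atTop (𝓝 1))
    (hX : Tendsto (fun n => (d n)⁻¹ • (g n - 1)) atTop (𝓝 X)) : Lyap C X := by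
  have aux : ∀ {k : ℕ → V →L[ℝ] V} {Y : V →L[ℝ] V}, (∀ n, ∀ x ∈ C, k n x ∈ C) →
      Tendsto (fun n => (d n)⁻¹ • (k n - 1)) atTop (𝓝 Y) →
      ∀ x ∈ C, ∀ y ∈ C, ⟪x, y⟫ = 0 → 0 ≤ ⟪Y x, y⟫ := by
    intro k Y hk hY x hx y hy hxy
    have h1 : Tendsto (fun n => ⟪((d n)⁻¹ • (k n - 1)) x, y⟫) atTop (𝓝 ⟪Y x, y⟫) := by
      have hc : Continuous (fun Z : V →L[ℝ] V => ⟪Z x, y⟫) := by fun_prop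
      exact (hc.tendsto Y).comp hY
    refine ge_of_tendsto' h1 fun n => ?_
    have h2 := h.nonneg (hk n x hx) hy
    have h3 := hd n
    simp only [_root_.smul_apply, _root_.sub_apply, one_apply_eq_self,
      inner_smul_left, inner_sub_left, hxy, conj_trivial, sub_zero]
    positivity
  have hX' : Tendsto (fun n => (d n)⁻¹ • (g' n - 1)) atTop (𝓝 (-X)) := by
    have h1 := (hg1.mul hX).neg
    rw [one_mul] at h1
    refine h1.congr fun n => ?_
    rw [mul_smul_comm, mul_sub, (hg n).2.1, mul_one, ← smul_neg, neg_sub]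
  intro x hx y hy hxy
  have a := aux (fun n => (hg n).2.2.1) hX x hx y hy hxy
  have b := aux (fun n => (hg n).2.2.2) hX' x hx y hy hxy
  simp only [_root_.neg_apply, inner_neg_left] at b
  linarith

/-- squared Hilbert–Schmidt norm -/
def hs (A : V →L[ℝ] V) : ℝ := ∑ i, ‖A (stdOrthonormalBasis ℝ V i)‖ ^ 2

lemma hs_cont : Continuous (hs : (V →L[ℝ] V) → ℝ) := by
  unfold hs; fun_prop

lemma hs_cont1 : Continuous (fun Z : V →L[ℝ] V => hs (Z - 1)) := by
  unfold hs; simp only [_root_.sub_apply]; fun_prop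

lemma hs_cont2 (g' : V →L[ℝ] V) : Continuous (fun Z : V →L[ℝ] V => hs (Z * g' - 1)) := by
  unfold hs; simp only [_root_.sub_apply, mul_apply_eq_comp]; fun_prop

lemma hs_zero {A : V →L[ℝ] V} (h : hs A = 0) : A = 0 := by
  have : (A : V →ₗ[ℝ] V) = 0 := by
    refine (stdOrthonormalBasis ℝ V).toBasis.ext fun i => ?_
    have := (Finset.sum_eq_zero_iff_of_nonneg (fun i _ => by positivity)).1 h i (Finset.mem_univ i)
    simpa using this
  ext x
  exact congrArg (fun f : V →ₗ[ℝ] V => f x) this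

set_option maxHeartbeats 400000 in
lemma slice_small (h : SD C) {u : V} (hu : u ∈ interior C)
    (hom : ∀ y ∈ interior C, ∃ g g', IsAut C g g' ∧ g u = y)
    {δ : ℝ} (hδ : 0 < δ) (hball : ∀ z : V, ‖z‖ ≤ δ → u + z ∈ interior C)
    {v : V} (hv0 : v ≠ 0) (hv : 2 * ‖v‖ ≤ δ) : ∃ X, Lyap C X ∧ X u = v := by
  set r : ℕ → ℝ := fun n => 1 / ((n : ℝ) + 1) with hr
  have hr0 : ∀ n, 0 < r n := fun n => by simp only [hr]; positivity
  have hr1 : ∀ n, r n ≤ 1 := fun n => by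
    simp only [hr]; rw [div_le_one (by positivity)]; linarith [(Nat.cast_nonneg n : (0 : ℝ) ≤ n)]
  have hrt : Tendsto r atTop (𝓝 0) := tendsto_one_div_add_atTop_nhds_zero_nat
  have hrv : ∀ n, ‖r n • v‖ ≤ ‖v‖ := fun n => by
    rw [norm_smul, Real.norm_eq_abs, abs_of_pos (hr0 n)]
    exact mul_le_of_le_one_left (norm_nonneg _) (hr1 n)
  set S : ℕ → Set ((V →L[ℝ] V) × (V →L[ℝ] V)) :=
    fun n => {p | IsAut C p.1 p.2 ∧ p.1 u = u + r n • v} with hS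
  obtain ⟨M, hM0, hM⟩ := h.bound hu
  set R : ℝ := max (M * (‖u‖ * (‖u‖ + ‖v‖))) (M * (2 * ⟪u, u⟫)) with hR
  have hSb : ∀ n, S n ⊆ Metric.closedBall 0 R := by
    rintro n ⟨g, g'⟩ ⟨hg, hgu⟩
    simp only at hg hgu
    rw [mem_closedBall_zero_iff, Prod.norm_def]
    refine max_le_max ?_ ?_
    · refine (hM g hg.2.2.1).trans ?_
      gcongr
      refine (real_inner_le_norm _ _).trans ?_
      gcongr
      rw [hgu]
      exact (norm_add_le _ _).trans (by gcongr; exact hrv n)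
    · refine (hM g' hg.2.2.2).trans ?_
      gcongr
      have h1 : u + (2 : ℝ) • (r n • v) ∈ C := interior_subset (hball _ (by
        rw [norm_smul, Real.norm_eq_abs, abs_of_pos two_pos]; linarith [hrv n]))
      have h2 := hg.2.2.2 _ h1
      have h3 : u + (2 : ℝ) • (r n • v) = (2 : ℝ) • g u - u := by rw [hgu]; module
      have h4 : g' (g u) = u := by
        have := congrArg (fun f : V →L[ℝ] V => f u) hg.2.1
        simpa using this
      rw [h3, map_sub, map_smul, h4] at h2
      have h5 := h.nonneg (interior_subset hu) h2
      rw [inner_sub_right, inner_smul_right] at h5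
      linarith
  have hSc : ∀ n, IsCompact (S n) := fun n => by
    refine Metric.isCompact_of_isClosed_isBounded ?_ (Metric.isBounded_closedBall.subset (hSb n))
    exact (isClosed_isAut h).inter (isClosed_eq (by fun_prop) (by fun_prop))
  have hSne : ∀ n, (S n).Nonempty := fun n => by
    obtain ⟨g, g', hg, hgu⟩ := hom _ (hball (r n • v) (by linarith [hrv n, norm_nonneg v]))
    exact ⟨(g, g'), hg, hgu⟩
  have hmin := fun n => (hSc n).exists_isMinOn (hSne n)
    (f := fun p => hs (p.1 - 1)) (hs_cont.comp (by fun_prop)).continuousOn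
  choose p hpS hpmin0 using hmin
  have hpmin : ∀ n (a b : V →L[ℝ] V), IsAut C a b → a u = u + r n • v →
      hs ((p n).1 - 1) ≤ hs (a - 1) := fun n a b hab hau =>
    isMinOn_iff.1 (hpmin0 n) (a, b) ⟨hab, hau⟩
  obtain ⟨⟨g, g'⟩, -, φ, hφ, hlim⟩ := tendsto_subseq_of_bounded
    (Metric.isBounded_closedBall (x := (0 : (V →L[ℝ] V) × (V →L[ℝ] V))) (r := R))
    (fun n => hSb n (hpS n))
  have hgaut : IsAut C g g' := (isClosed_isAut h).mem_of_tendsto hlim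
    (Eventually.of_forall fun n => (hpS (φ n)).1)
  have hl1 : Tendsto (fun n => (p (φ n)).1) atTop (𝓝 g) := (continuous_fst.tendsto _).comp hlim
  have hl2 : Tendsto (fun n => (p (φ n)).2) atTop (𝓝 g') := (continuous_snd.tendsto _).comp hlim
  have hgu : g u = u := by
    have c1 : Tendsto (fun n => (p (φ n)).1 u) atTop (𝓝 (g u)) :=
      ((by fun_prop : Continuous fun Z : V →L[ℝ] V => Z u).tendsto g).comp hl1
    have c2 : Tendsto (fun n => (p (φ n)).1 u) atTop (𝓝 (u + (0 : ℝ) • v)) := by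
      have : (fun n => (p (φ n)).1 u) = fun n => u + r (φ n) • v := funext fun n => (hpS (φ n)).2
      rw [this]
      exact tendsto_const_nhds.add ((hrt.comp hφ.tendsto_atTop).smul_const v)
    rw [zero_smul, add_zero] at c2
    exact tendsto_nhds_unique c1 c2
  have hg'u : g' u = u := by
    have := congrArg (fun f : V →L[ℝ] V => f u) hgaut.2.1
    simpa [hgu] using this
  have hg1 : g = 1 := by
    have k1 := hs_cont1 (V := V)
    have k2 := hs_cont2 g'
    have c1 : Tendsto (fun n => hs ((p (φ n)).1 - 1)) atTop (𝓝 (hs (g - 1))) :=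
      (k1.tendsto g).comp hl1
    have c2 : Tendsto (fun n => hs ((p (φ n)).1 * g' - 1)) atTop (𝓝 (hs (g * g' - 1))) :=
      (k2.tendsto g).comp hl1
    have c3 : hs (g - 1) ≤ hs (g * g' - 1) := le_of_tendsto_of_tendsto' c1 c2 fun n =>
      hpmin (φ n) _ _ ((hpS (φ n)).1.mul hgaut.symm) (by
        rw [mul_apply_eq_comp, hg'u, (hpS (φ n)).2])
    rw [hgaut.1, sub_self] at c3
    have c4 : hs (0 : V →L[ℝ] V) = 0 := by simp [hs]
    have c5 : 0 ≤ hs (g - 1) := Finset.sum_nonneg fun i _ => by positivity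
    exact sub_eq_zero.1 (hs_zero (by linarith))
  have hg'1 : g' = 1 := by have := hgaut.1; rwa [hg1, one_mul] at this
  rw [hg1] at hl1
  rw [hg'1] at hl2
  set d : ℕ → ℝ := fun n => ‖(p (φ n)).1 - 1‖ with hd
  have hd0 : ∀ n, 0 < d n := fun n => by
    refine norm_pos_iff.2 fun h0 => hv0 ?_
    have h1 := (hpS (φ n)).2
    rw [sub_eq_zero.1 h0] at h1
    have : r (φ n) • v = 0 := by simpa using h1.symm
    exact (smul_eq_zero.1 this).resolve_left (hr0 _).ne'
  set Y : ℕ → V →L[ℝ] V := fun n => (d n)⁻¹ • ((p (φ n)).1 - 1) with hY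
  have hYn : ∀ n, ‖Y n‖ = 1 := fun n => by
    simp only [hY, norm_smul, norm_inv, Real.norm_eq_abs, abs_of_pos (hd0 n)]
    exact inv_mul_cancel₀ (hd0 n).ne'
  obtain ⟨X, -, ψ, hψ, hXl⟩ := tendsto_subseq_of_bounded
    (Metric.isBounded_closedBall (x := (0 : V →L[ℝ] V)) (r := 1))
    (x := Y) (fun n => by simp [hYn n])
  have hX1 : ‖X‖ = 1 := by
    have c1 := hXl.norm
    have c2 : (fun n => ‖(Y ∘ ψ) n‖) = fun _ => (1 : ℝ) := funext fun n => hYn _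
    rw [c2] at c1
    exact tendsto_nhds_unique c1 tendsto_const_nhds
  have hXL : Lyap C X := Lyap.of_tendsto h (g := fun n => (p (φ (ψ n))).1)
    (g' := fun n => (p (φ (ψ n))).2) (d := fun n => d (ψ n)) (fun n => (hpS _).1)
    (fun n => hd0 _) (hl2.comp hψ.tendsto_atTop) hXl
  have hXu : Tendsto (fun n => ((d (ψ n))⁻¹ * r (φ (ψ n))) • v) atTop (𝓝 (X u)) := by
    have c1 : Tendsto (fun n => (Y (ψ n)) u) atTop (𝓝 (X u)) :=
      ((by fun_prop : Continuous fun Z : V →L[ℝ] V => Z u).tendsto X).comp hXl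
    refine c1.congr fun n => ?_
    simp [hY, (hpS (φ (ψ n))).2, smul_smul]
  have hvn : ‖v‖ ≠ 0 := norm_ne_zero_iff.2 hv0
  have hc : Tendsto (fun n => (d (ψ n))⁻¹ * r (φ (ψ n))) atTop (𝓝 (‖X u‖ / ‖v‖)) := by
    have c1 := hXu.norm.div_const ‖v‖
    refine c1.congr fun n => ?_
    rw [norm_smul, Real.norm_eq_abs, abs_of_pos (mul_pos (inv_pos.2 (hd0 _)) (hr0 _))]
    field_simp
  have hXuv : X u = (‖X u‖ / ‖v‖) • v := tendsto_nhds_unique hXu (hc.smul_const v)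
  rcases eq_or_ne (X u) 0 with hz | hz
  · exfalso
    have hder : ∀ n, ∑ i, ⟪(p (φ n)).1 (X (stdOrthonormalBasis ℝ V i)),
        ((p (φ n)).1 - 1) (stdOrthonormalBasis ℝ V i)⟫ = 0 := by
      intro n
      set G := (p (φ n)).1 with hG
      have hmn : ∀ s : ℝ, hs (G - 1) ≤ hs (G * NormedSpace.exp (s • X) - 1) := fun s =>
        hpmin (φ n) _ _ ((hpS (φ n)).1.mul ((hXL.smul s).aut h hu)) (by
          have : NormedSpace.exp (s • X) u = u := exp_fix (by simp [hz])
          rw [mul_apply_eq_comp, this, (hpS (φ n)).2])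
      have hdd : HasDerivAt (fun s : ℝ => hs (G * NormedSpace.exp (s • X) - 1))
          (∑ i, 2 * ⟪(G - 1) (stdOrthonormalBasis ℝ V i), G (X (stdOrthonormalBasis ℝ V i))⟫) 0 := by
        unfold hs
        refine HasDerivAt.fun_sum fun i _ => ?_
        have e1 := hasDerivAt_exp_apply X (stdOrthonormalBasis ℝ V i) 0
        have e2 := ((hasDerivAt_const (0 : ℝ) G).clm_apply e1).sub_const (stdOrthonormalBasis ℝ V i)
        have e3 := e2.norm_sq
        simpa using e3
      have hloc : IsLocalMin (fun s : ℝ => hs (G * NormedSpace.exp (s • X) - 1)) 0 :=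
        Eventually.of_forall fun s => by simpa using hmn s
      have := hloc.hasDerivAt_eq_zero hdd
      rw [← Finset.mul_sum] at this
      have h2 := (mul_eq_zero.1 this).resolve_left two_ne_zero
      rw [← h2]
      exact Finset.sum_congr rfl fun i _ => real_inner_comm _ _
    have hlim2 : Tendsto (fun n => ∑ i, ⟪(p (φ (ψ n))).1 (X (stdOrthonormalBasis ℝ V i)),
        (Y (ψ n)) (stdOrthonormalBasis ℝ V i)⟫) atTop
        (𝓝 (∑ i, ⟪(1 : V →L[ℝ] V) (X (stdOrthonormalBasis ℝ V i)),
          X (stdOrthonormalBasis ℝ V i)⟫)) := by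
      refine tendsto_finsetSum _ fun i _ => ?_
      refine Tendsto.inner ?_ ?_
      · exact ((by fun_prop : Continuous fun Z : V →L[ℝ] V =>
          Z (X (stdOrthonormalBasis ℝ V i))).tendsto 1).comp (hl1.comp hψ.tendsto_atTop)
      · exact ((by fun_prop : Continuous fun Z : V →L[ℝ] V =>
          Z (stdOrthonormalBasis ℝ V i)).tendsto X).comp hXl
    have hzero : (fun n => ∑ i, ⟪(p (φ (ψ n))).1 (X (stdOrthonormalBasis ℝ V i)),
        (Y (ψ n)) (stdOrthonormalBasis ℝ V i)⟫) = fun _ => (0 : ℝ) := by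
      funext n
      have := hder (ψ n)
      simp only [hY, _root_.smul_apply, inner_smul_right, ← Finset.mul_sum, this,
        mul_zero]
    rw [hzero] at hlim2
    have hfin := tendsto_nhds_unique hlim2 tendsto_const_nhds
    simp only [one_apply_eq_self, real_inner_self_eq_norm_sq] at hfin
    have : X = 0 := hs_zero hfin
    rw [this, norm_zero] at hX1
    exact zero_ne_one hX1
  · have hcz : ‖X u‖ / ‖v‖ ≠ 0 := div_ne_zero (norm_ne_zero_iff.2 hz) hvn
    refine ⟨(‖X u‖ / ‖v‖)⁻¹ • X, hXL.smul _, ?_⟩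
    rw [_root_.smul_apply]
    nth_rw 2 [hXuv]
    rw [smul_smul, inv_mul_cancel₀ hcz, one_smul]

lemma slice (h : SD C) {u : V} (hu : u ∈ interior C)
    (hom : ∀ y ∈ interior C, ∃ g g', IsAut C g g' ∧ g u = y) (v : V) :
    ∃ X, Lyap C X ∧ X u = v := by
  rcases eq_or_ne v 0 with rfl | hv
  · exact ⟨0, fun x _ y _ _ => by simp, by simp⟩
  obtain ⟨ε, hε, hb⟩ := Metric.isOpen_iff.1 isOpen_interior u hu
  have hn : 0 < ‖v‖ := norm_pos_iff.2 hv
  have hc : 0 < ε / 4 / ‖v‖ := by positivity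
  obtain ⟨X, hX, hXu⟩ := slice_small h hu hom (δ := ε / 2) (by positivity)
    (fun z hz => hb (by simp [dist_eq_norm]; linarith)) (v := (ε / 4 / ‖v‖) • v)
    (smul_ne_zero hc.ne' hv)
    (by rw [norm_smul, Real.norm_eq_abs, abs_of_pos hc]; field_simp; norm_num)
  refine ⟨(ε / 4 / ‖v‖)⁻¹ • X, hX.smul _, ?_⟩
  rw [_root_.smul_apply, hXu, smul_smul, inv_mul_cancel₀ hc.ne', one_smul]

lemma exists_fixed (h : SD C) (hne : (interior C).Nonempty) :
    ∃ u ∈ interior C, ∀ g g' : V →L[ℝ] V, IsAut C g g' → (∀ x, ‖g x‖ = ‖x‖) → g u = u := by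
  set S : Set V := {x | ∀ y ∈ C, ‖y‖ ≤ ⟪x, y⟫} with hS
  have hSne : S.Nonempty := by
    obtain ⟨x, hx⟩ := hne
    obtain ⟨δ, hδ, -, h2⟩ := h.of_interior hx
    refine ⟨δ⁻¹ • x, fun y hy => ?_⟩
    rw [inner_smul_left]
    have := h2 y hy
    simp only [conj_trivial]
    rw [inv_mul_eq_div, le_div_iff₀ hδ]; linarith
  have hSc : IsClosed S := by
    have : S = ⋂ y ∈ C, {x : V | ‖y‖ ≤ ⟪x, y⟫} := by ext; simp [hS]
    rw [this]
    exact isClosed_biInter fun y _ => isClosed_le continuous_const (by fun_prop)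
  have hSconv : Convex ℝ S := by
    intro x hx z hz a b ha hb hab y hy
    have h1 := hx y hy
    have h2 := hz y hy
    rw [inner_add_left, inner_smul_left, inner_smul_left]
    simp only [conj_trivial]
    calc ‖y‖ = a * ‖y‖ + b * ‖y‖ := by rw [← add_mul, hab, one_mul]
      _ ≤ _ := by gcongr
  obtain ⟨u, huS, hmin⟩ := exists_norm_eq_iInf_of_complete_convex hSne hSc.isComplete hSconv 0
  have hmin' : ∀ w ∈ S, ‖u‖ ≤ ‖w‖ := by
    intro w hw
    have h1 : (⨅ w : S, ‖(0 : V) - w‖) ≤ ‖(0 : V) - w‖ :=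
      ciInf_le (f := fun w : S => ‖(0 : V) - w‖) ⟨0, by rintro _ ⟨w, rfl⟩; exact norm_nonneg _⟩ ⟨w, hw⟩
    rw [← hmin] at h1
    simpa using h1
  refine ⟨u, h.interior_of one_pos (fun y hy => by simpa using huS y hy), fun g g' hg hiso => ?_⟩
  have hgg : ∀ x, g (g' x) = x := fun x => by
    have := congrArg (fun f : V →L[ℝ] V => f x) hg.1
    simpa using this
  let gi : V →ₗᵢ[ℝ] V := ⟨g.toLinearMap, hiso⟩
  have hgS : g u ∈ S := by
    intro y hy
    have h1 := huS (g' y) (hg.2.2.2 y hy)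
    have h2 : ⟪g u, g (g' y)⟫ = ⟪u, g' y⟫ := gi.inner_map_map u (g' y)
    have h3 := hiso (g' y)
    rw [hgg] at h2 h3
    rw [h2, h3]; exact h1
  have hmid : (1 / 2 : ℝ) • u + (1 / 2 : ℝ) • g u ∈ S :=
    hSconv huS hgS (by norm_num) (by norm_num) (by norm_num)
  have h1 := hmin' _ hmid
  rw [← smul_add, norm_smul] at h1
  norm_num at h1
  have h2 := parallelogram_law_with_norm ℝ u (g u)
  rw [hiso u] at h2
  have h3 : ‖u - g u‖ = 0 := by
    nlinarith [norm_nonneg (u - g u), norm_nonneg (u + g u), norm_nonneg u]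
  exact (sub_eq_zero.1 (norm_eq_zero.1 h3)).symm

end Slice

end QK

namespace QK

open Filter Topology

section KV

variable {V : Type*} [NormedAddCommGroup V] [InnerProductSpace ℝ V] [FiniteDimensional ℝ V]
  {C : Set V}

/-- Euclidean Jordan structure attached to a homogeneous self-dual cone -/
structure KV (C : Set V) (u : V) (L : V →ₗ[ℝ] (V →L[ℝ] V)) : Prop where
  lyap : ∀ z, Lyap C (L z)
  sym : ∀ z x y, ⟪L z x, y⟫ = ⟪x, L z y⟫
  unit : ∀ z, L z u = z
  uniq : ∀ S : V →L[ℝ] V, Lyap C S → (∀ x y, ⟪S x, y⟫ = ⟪x, S y⟫) → S = L (S u)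
  comm : ∀ x y, L x y = L y x
  der : ∀ x y z w, L x (L y (L z w)) - L y (L x (L z w)) =
    L (L x (L y z) - L y (L x z)) w + L z (L x (L y w) - L y (L x w))

lemma exists_KV (h : SD C) {u : V} (hu : u ∈ interior C)
    (hfix : ∀ g g' : V →L[ℝ] V, IsAut C g g' → (∀ x, ‖g x‖ = ‖x‖) → g u = u)
    (hom : ∀ y ∈ interior C, ∃ g g', IsAut C g g' ∧ g u = y) :
    ∃ L, KV C u L := by
  have hex : ∀ z : V, ∃ S : V →L[ℝ] V, Lyap C S ∧ (∀ x y, ⟪S x, y⟫ = ⟪x, S y⟫) ∧ S u = z := by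
    intro z
    obtain ⟨X, hX, hXu⟩ := slice h hu hom z
    set X' := ContinuousLinearMap.adjoint X with hX'
    have hK : Lyap C ((1 / 2 : ℝ) • (X - X')) := (hX.sub hX.adj).smul _
    have hKu : ((1 / 2 : ℝ) • (X - X')) u = 0 := hK.skew_kill h hu hfix fun x => by
      simp only [_root_.smul_apply, _root_.sub_apply, inner_smul_left, inner_sub_left, hX',
        ContinuousLinearMap.adjoint_inner_left]
      rw [real_inner_comm x (X x)]; simp
    refine ⟨(1 / 2 : ℝ) • (X + X'), (hX.add hX.adj).smul _, fun x y => ?_, ?_⟩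
    · simp only [_root_.smul_apply, _root_.add_apply, inner_smul_left, inner_add_left, hX',
        ContinuousLinearMap.adjoint_inner_left, inner_smul_right, inner_add_right,
        ContinuousLinearMap.adjoint_inner_right, conj_trivial]
      ring
    · have : (1 / 2 : ℝ) • (X + X') = X - (1 / 2 : ℝ) • (X - X') := by module
      rw [this, _root_.sub_apply, hKu, hXu, sub_zero]
  choose S hSL hSs hSu using hex
  have huniq : ∀ T : V →L[ℝ] V, Lyap C T → (∀ x y, ⟪T x, y⟫ = ⟪x, T y⟫) → T = S (T u) := by
    intro T hT hTs
    refine sub_eq_zero.1 ((hT.sub (hSL (T u))).sym_zero h hu (fun x y => ?_) ?_)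
    · simp only [_root_.sub_apply, inner_sub_left, inner_sub_right, hTs, hSs]
    · simp [hSu]
  let L : V →ₗ[ℝ] (V →L[ℝ] V) :=
    { toFun := S
      map_add' := fun x y => by
        have := huniq (S x + S y) ((hSL x).add (hSL y)) (fun a b => by
          simp only [_root_.add_apply, inner_add_left, inner_add_right, hSs])
        rw [this]; simp [hSu]
      map_smul' := fun c x => by
        have := huniq (c • S x) ((hSL x).smul c) (fun a b => by
          simp only [_root_.smul_apply, inner_smul_left, inner_smul_right, hSs, conj_trivial])
        simp only [RingHom.id_apply]
        rw [this]; simp [hSu] }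
  have hcomm : ∀ x y, S x y = S y x := by
    intro x y
    have := ((hSL x).comm h hu (hSL y)).skew_kill h hu hfix (fun z => by
      simp only [_root_.sub_apply, mul_apply_eq_comp, inner_sub_left]
      rw [hSs x, hSs y, real_inner_comm]; simp)
    simp only [_root_.sub_apply, mul_apply_eq_comp, hSu] at this
    exact sub_eq_zero.1 this
  refine ⟨L, hSL, hSs, hSu, huniq, hcomm, ?_⟩
  intro x y z w
  have hD : Lyap C (S x * S y - S y * S x) := (hSL x).comm h hu (hSL y)
  have hDD := hD.comm h hu (hSL z)
  have hkill : (S x * S y - S y * S x) u = 0 := by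
    simp only [_root_.sub_apply, mul_apply_eq_comp, hSu, hcomm x y, sub_self]
  have key := huniq _ hDD (fun a b => by
    simp only [_root_.sub_apply, mul_apply_eq_comp, inner_sub_left, inner_sub_right, hSs, map_sub]
    ring)
  have key2 : ((S x * S y - S y * S x) * S z - S z * (S x * S y - S y * S x)) u =
      S x (S y z) - S y (S x z) := by
    rw [_root_.sub_apply, mul_apply_eq_comp, mul_apply_eq_comp, hkill, hSu]
    simp
  rw [key2] at key
  have key3 := congrArg (fun f : V →L[ℝ] V => f w) key
  simp only [_root_.sub_apply, mul_apply_eq_comp] at key3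
  change S x (S y (S z w)) - S y (S x (S z w)) =
    S (S x (S y z) - S y (S x z)) w + S z (S x (S y w) - S y (S x w))
  rw [← key3]; abel

lemma KV.jordan {u : V} {L : V →ₗ[ℝ] (V →L[ℝ] V)} (k : KV C u L) (a x y w : V) :
    (L a (L (L x y) w) - L (L x y) (L a w)) + (L x (L (L y a) w) - L (L y a) (L x w)) +
      (L y (L (L a x) w) - L (L a x) (L y w)) = 0 := by
  have O : ∀ b, L a (L (L x y) b) - L (L a (L x y)) b =
      (L y (L a (L x b)) - L y (L (L a x) b)) + (L x (L a (L y b)) - L x (L (L a y) b)) := by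
    intro b
    have := k.der a b x y
    rw [k.comm b (L x y), k.comm b (L a (L x y)), k.comm b x, k.comm b (L a x), k.comm b y,
      k.comm b (L a y), k.comm (L a (L x b) - L (L a x) b) y, map_sub (L y), map_sub (L x)] at this
    exact this
  refine ext_inner_right ℝ fun c => ?_
  have h1 := congrArg (fun z => ⟪z, c⟫) (O w)
  have h2 := congrArg (fun z => ⟪z, w⟫) (O c)
  have s1 : ∀ p, ⟪L p c, w⟫ = ⟪L p w, c⟫ := fun p => by rw [k.sym, real_inner_comm]
  have s2 : ∀ p q, ⟪L p (L q c), w⟫ = ⟪L q (L p w), c⟫ := fun p q => by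
    rw [k.sym, k.sym, real_inner_comm]
  have s3 : ∀ p q r, ⟪L p (L q (L r c)), w⟫ = ⟪L r (L q (L p w)), c⟫ := fun p q r => by
    rw [k.sym, k.sym, k.sym, real_inner_comm]
  simp only [inner_sub_left, inner_add_left, s1, s2, s3] at h1 h2
  rw [k.comm y a]
  simp only [inner_sub_left, inner_add_left, inner_zero_left]
  linarith

end KV

end QK

namespace QK

section Alg

variable {E V : Type*} [NormedAddCommGroup E] [InnerProductSpace ℝ E] [FiniteDimensional ℝ E]
  [NormedAddCommGroup V] [InnerProductSpace ℝ V] [FiniteDimensional ℝ V]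
  {C : Set V} {L : V →ₗ[ℝ] (V →L[ℝ] V)} {w : E} {B0 B1 B2 B3 : E →ₗ[ℝ] V}

/-- composite with a qubit, in Pauli coordinates -/
structure Pa (C : Set V) (L : V →ₗ[ℝ] (V →L[ℝ] V)) (w : E) (B0 B1 B2 B3 : E →ₗ[ℝ] V) : Prop where
  kv : KV C (B0 w) L
  inj : ∀ a b c d, B0 a + B1 b + B2 c + B3 d = 0 → a = 0 ∧ b = 0 ∧ c = 0 ∧ d = 0
  span : ∀ z, ∃ a b c d, z = B0 a + B1 b + B2 c + B3 d
  s10 : ∀ a, L (B1 w) (B0 a) = B1 a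
  s11 : ∀ a, L (B1 w) (B1 a) = B0 a
  s12 : ∀ a, L (B1 w) (B2 a) = 0
  s13 : ∀ a, L (B1 w) (B3 a) = 0
  s20 : ∀ a, L (B2 w) (B0 a) = B2 a
  s21 : ∀ a, L (B2 w) (B1 a) = 0
  s22 : ∀ a, L (B2 w) (B2 a) = B0 a
  s23 : ∀ a, L (B2 w) (B3 a) = 0
  s30 : ∀ a, L (B3 w) (B0 a) = B3 a
  s31 : ∀ a, L (B3 w) (B1 a) = 0
  s32 : ∀ a, L (B3 w) (B2 a) = 0
  s33 : ∀ a, L (B3 w) (B3 a) = B0 a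
  n0 : ∀ a b, ⟪B0 a, B0 b⟫ = 2 * ⟪a, b⟫
  n1 : ∀ a b, ⟪B1 a, B1 b⟫ = 2 * ⟪a, b⟫
  n2 : ∀ a b, ⟪B2 a, B2 b⟫ = 2 * ⟪a, b⟫
  n3 : ∀ a b, ⟪B3 a, B3 b⟫ = 2 * ⟪a, b⟫

namespace Pa

lemma rot (p : Pa C L w B0 B1 B2 B3) : Pa C L w B0 B2 B3 B1 where
  kv := p.kv
  inj := fun a b c d h => by
    obtain ⟨h1, h2, h3, h4⟩ := p.inj a d b c (by rw [← h]; abel)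
    exact ⟨h1, h3, h4, h2⟩
  span := fun z => by
    obtain ⟨a, b, c, d, h⟩ := p.span z
    exact ⟨a, c, d, b, by rw [h]; abel⟩
  s10 := p.s20
  s11 := p.s22
  s12 := p.s23
  s13 := p.s21
  s20 := p.s30
  s21 := p.s32
  s22 := p.s33
  s23 := p.s31
  s30 := p.s10
  s31 := p.s12
  s32 := p.s13
  s33 := p.s11
  n0 := p.n0
  n1 := p.n2
  n2 := p.n3
  n3 := p.n1

lemma swap (p : Pa C L w B0 B1 B2 B3) : Pa C L w B0 B2 B1 B3 where
  kv := p.kv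
  inj := fun a b c d h => by
    obtain ⟨h1, h2, h3, h4⟩ := p.inj a c b d (by rw [← h]; abel)
    exact ⟨h1, h3, h2, h4⟩
  span := fun z => by
    obtain ⟨a, b, c, d, h⟩ := p.span z
    exact ⟨a, c, b, d, by rw [h]; abel⟩
  s10 := p.s20
  s11 := p.s22
  s12 := p.s21
  s13 := p.s23
  s20 := p.s10
  s21 := p.s12
  s22 := p.s11
  s23 := p.s13
  s30 := p.s30
  s31 := p.s32
  s32 := p.s31
  s33 := p.s33
  n0 := p.n0
  n1 := p.n2
  n2 := p.n1
  n3 := p.n3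

lemma i0 (p : Pa C L w B0 B1 B2 B3) {a b : E} (h : B0 a = B0 b) : a = b := by
  have := (p.inj (a - b) 0 0 0 (by simp [h])).1
  exact sub_eq_zero.1 this

lemma i1 (p : Pa C L w B0 B1 B2 B3) {a b : E} (h : B1 a = B1 b) : a = b := by
  have := (p.inj 0 (a - b) 0 0 (by simp [h])).2.1
  exact sub_eq_zero.1 this

lemma unit_left (p : Pa C L w B0 B1 B2 B3) (z : V) : L (B0 w) z = z := by
  rw [p.kv.comm, p.kv.unit]

lemma comm0 (p : Pa C L w B0 B1 B2 B3) (a : E) (z : V) :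
    L (B1 w) (L (B0 a) z) = L (B0 a) (L (B1 w) z) := by
  have := p.kv.jordan (B1 a) (B1 w) (B1 w) z
  rw [p.kv.comm (B1 a) (B1 w), p.s11, p.s11, p.unit_left, p.unit_left, sub_self, zero_add,
    ← two_smul ℝ] at this
  exact sub_eq_zero.1 ((smul_eq_zero.1 this).resolve_left two_ne_zero)

lemma comm1 (p : Pa C L w B0 B1 B2 B3) (a : E) (z : V) :
    L (B1 w) (L (B1 a) z) = L (B1 a) (L (B1 w) z) := by
  have := p.kv.jordan (B0 a) (B1 w) (B1 w) z
  rw [p.kv.comm (B0 a) (B1 w), p.s11, p.s10, p.unit_left, p.unit_left, sub_self, zero_add,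
    ← two_smul ℝ] at this
  exact sub_eq_zero.1 ((smul_eq_zero.1 this).resolve_left two_ne_zero)

lemma L00_aux (p : Pa C L w B0 B1 B2 B3) (a b : E) {c0 c1 c2 c3 : E}
    (h : L (B0 a) (B0 b) = B0 c0 + B1 c1 + B2 c2 + B3 c3) : c1 = 0 := by
  have h1 : L (B2 w) (L (B1 w) (L (B0 a) (B0 b))) = 0 := by
    rw [p.comm0, p.rot.comm0, p.s10, p.s21, map_zero]
  rw [h] at h1
  simp only [map_add, p.s10, p.s11, p.s12, p.s13, p.s20, p.s21, add_zero, zero_add, map_zero] at h1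
  exact (p.inj 0 0 c1 0 (by simp [h1])).2.2.1

lemma L00 (p : Pa C L w B0 B1 B2 B3) (a b : E) : ∃ c, L (B0 a) (B0 b) = B0 c := by
  obtain ⟨c0, c1, c2, c3, h⟩ := p.span (L (B0 a) (B0 b))
  have h1 := p.L00_aux a b h
  have h2 := p.rot.L00_aux a b (c0 := c0) (c1 := c2) (c2 := c3) (c3 := c1) (by rw [h]; abel)
  have h3 := p.rot.rot.L00_aux a b (c0 := c0) (c1 := c3) (c2 := c1) (c3 := c2) (by rw [h]; abel)
  exact ⟨c0, by rw [h, h1, h2, h3]; simp⟩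

lemma L31_aux (p : Pa C L w B0 B1 B2 B3) (a b : E) : ∃ c d, L (B3 a) (B1 b) = B1 c + B2 d := by
  obtain ⟨c0, c1, c2, c3, h⟩ := p.span (L (B3 a) (B1 b))
  have D : ∀ z, L (B1 w) (L (B2 w) (L (B3 a) z)) - L (B2 w) (L (B1 w) (L (B3 a) z)) =
      L (B3 a) (L (B1 w) (L (B2 w) z) - L (B2 w) (L (B1 w) z)) := by
    intro z
    have := p.kv.der (B1 w) (B2 w) (B3 a) z
    rw [p.s13, p.s23] at this
    simpa using this
  have h1 := D (B1 b)
  rw [p.s21, p.s11, p.s20, map_zero, zero_sub, map_neg, h] at h1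
  simp only [map_add, p.s10, p.s11, p.s12, p.s13, p.s20, p.s21, p.s22, p.s23, add_zero, zero_add,
    map_zero] at h1
  have h2 := D (B2 b)
  rw [p.s12, p.s22, p.s10, map_zero, sub_zero, ← neg_eq_iff_eq_neg.2 h1] at h2
  simp only [map_add, map_sub, map_neg, p.s10, p.s11, p.s12, p.s13, p.s20, p.s21, p.s22, p.s23,
    add_zero, zero_add, map_zero, sub_zero, neg_zero] at h2
  rw [h] at h2
  refine ⟨c1, c2, ?_⟩
  have h3 := p.inj c0 (c1 - c1) (c2 - c2) c3 (by
    simp only [map_sub]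
    have h4 := sub_eq_zero.2 h2
    rw [← neg_eq_zero, ← h4]
    abel)
  rw [h, h3.1, h3.2.2.2]; simp

end Pa

end Alg

end QK

namespace QK

section Alg

variable {E V : Type*} [NormedAddCommGroup E] [InnerProductSpace ℝ E] [FiniteDimensional ℝ E]
  [NormedAddCommGroup V] [InnerProductSpace ℝ V] [FiniteDimensional ℝ V]
  {C : Set V} {L : V →ₗ[ℝ] (V →L[ℝ] V)} {w : E} {B0 B1 B2 B3 : E →ₗ[ℝ] V}

/-- self-adjoint part of a complex associative algebra: Jordan product and commutator -/
structure JA (w : E) (P T : E →ₗ[ℝ] E →ₗ[ℝ] E) : Prop where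
  pcomm : ∀ a b, P a b = P b a
  tanti : ∀ a b, T a b = - T b a
  pw : ∀ a, P w a = a
  tw : ∀ a, T w a = 0
  psym : ∀ a b c, ⟪P a b, c⟫ = ⟪b, P a c⟫
  tskew : ∀ a b c, ⟪T a b, c⟫ = - ⟪b, T a c⟫
  re : ∀ a b c, P a (P b c) - T a (T b c) = P (P a b) c - T (T a b) c
  im : ∀ a b c, P a (T b c) + T a (P b c) = T (P a b) c + P (T a b) c

namespace Pa

lemma existsP (p : Pa C L w B0 B1 B2 B3) :
    ∃ P : E →ₗ[ℝ] E →ₗ[ℝ] E, ∀ a b, L (B0 a) (B0 b) = B0 (P a b) := by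
  obtain ⟨g, hg⟩ := LinearMap.exists_leftInverse_of_injective B0
    (LinearMap.ker_eq_bot.2 fun a b h => p.i0 h)
  have hg' : ∀ a, g (B0 a) = a := fun a => congrArg (fun f : E →ₗ[ℝ] E => f a) hg
  refine ⟨LinearMap.mk₂ ℝ (fun a b => g (L (B0 a) (B0 b))) (by intros; simp) (by intros; simp)
    (by intros; simp) (by intros; simp), fun a b => ?_⟩
  obtain ⟨c, hc⟩ := p.L00 a b
  rw [LinearMap.mk₂_apply, hc, hg']

variable {P T : E →ₗ[ℝ] E →ₗ[ℝ] E}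

lemma Pcomm (p : Pa C L w B0 B1 B2 B3) (hP : ∀ a b, L (B0 a) (B0 b) = B0 (P a b)) (a b : E) :
    P a b = P b a := p.i0 (by rw [← hP, ← hP, p.kv.comm])

lemma L01 (p : Pa C L w B0 B1 B2 B3) (hP : ∀ a b, L (B0 a) (B0 b) = B0 (P a b)) (a b : E) :
    L (B0 a) (B1 b) = B1 (P a b) := by
  rw [← p.s10 b, ← p.comm0, hP, p.s10]

lemma L10 (p : Pa C L w B0 B1 B2 B3) (hP : ∀ a b, L (B0 a) (B0 b) = B0 (P a b)) (a b : E) :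
    L (B1 a) (B0 b) = B1 (P a b) := by
  rw [p.kv.comm, p.L01 hP, p.Pcomm hP]

lemma L11 (p : Pa C L w B0 B1 B2 B3) (hP : ∀ a b, L (B0 a) (B0 b) = B0 (P a b)) (a b : E) :
    L (B1 a) (B1 b) = B0 (P a b) := by
  rw [← p.s10 b, ← p.comm1, p.L10 hP, p.s11]

lemma L31 (p : Pa C L w B0 B1 B2 B3) (hP : ∀ a b, L (B0 a) (B0 b) = B0 (P a b)) (a b : E) :
    L (B3 a) (B1 b) = - L (B1 a) (B3 b) := by
  have := p.kv.jordan (B0 a) (B1 w) (B3 w) (B0 b)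
  rw [p.s13, p.s30, p.kv.comm (B0 a) (B1 w), p.s10, p.s10, p.s30, p.rot.rot.L10 hP, p.L10 hP,
    p.s13, p.s31] at this
  simp only [map_zero, _root_.zero_apply, sub_zero, zero_sub, zero_add] at this
  rw [← neg_add, neg_eq_zero] at this
  exact eq_neg_of_add_eq_zero_left this

lemma L12 (p : Pa C L w B0 B1 B2 B3) (hP : ∀ a b, L (B0 a) (B0 b) = B0 (P a b)) (a b : E) :
    ∃ c, L (B1 a) (B2 b) = B3 c := by
  obtain ⟨c, d, h1⟩ := p.rot.L31_aux a b
  obtain ⟨c', d', h2⟩ := p.swap.rot.L31_aux a b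
  have h3 := p.rot.L31 hP a b
  rw [h1, h2] at h3
  have h4 := p.inj 0 c' c (d + d') (by
    have := sub_eq_zero.2 h3
    rw [← this, map_zero, map_add]; abel)
  exact ⟨d, by rw [h1, h4.2.2.1]; simp⟩

lemma existsT (p : Pa C L w B0 B1 B2 B3) (hP : ∀ a b, L (B0 a) (B0 b) = B0 (P a b)) :
    ∃ T : E →ₗ[ℝ] E →ₗ[ℝ] E, ∀ a b, L (B1 a) (B2 b) = B3 (T a b) := by
  obtain ⟨g, hg⟩ := LinearMap.exists_leftInverse_of_injective B3
    (LinearMap.ker_eq_bot.2 fun a b h => p.rot.rot.i1 h)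
  have hg' : ∀ a, g (B3 a) = a := fun a => congrArg (fun f : E →ₗ[ℝ] E => f a) hg
  refine ⟨LinearMap.mk₂ ℝ (fun a b => g (L (B1 a) (B2 b))) (by intros; simp) (by intros; simp)
    (by intros; simp) (by intros; simp), fun a b => ?_⟩
  obtain ⟨c, hc⟩ := p.L12 hP a b
  rw [LinearMap.mk₂_apply, hc, hg']

lemma T13 (p : Pa C L w B0 B1 B2 B3) (hT : ∀ a b, L (B1 a) (B2 b) = B3 (T a b)) (a b : E) :
    L (B1 a) (B3 b) = - B2 (T a b) := by
  have := p.kv.der (B2 w) (B3 w) (B1 a) (B2 b)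
  rw [hT, p.s33, p.s20, p.s23, p.s31, p.s21, p.s32, p.s22, p.s30] at this
  simp only [map_zero, _root_.zero_apply, sub_zero, zero_sub, zero_add, map_neg] at this
  rw [this, neg_neg]

lemma T31 (p : Pa C L w B0 B1 B2 B3) (hP : ∀ a b, L (B0 a) (B0 b) = B0 (P a b))
    (hT : ∀ a b, L (B1 a) (B2 b) = B3 (T a b)) (a b : E) :
    L (B3 a) (B1 b) = B2 (T a b) := by
  rw [p.L31 hP, p.T13 hT, neg_neg]

lemma existsJA (p : Pa C L w B0 B1 B2 B3) : ∃ P T : E →ₗ[ℝ] E →ₗ[ℝ] E,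
    (∀ a b, L (B0 a) (B0 b) = B0 (P a b)) ∧ JA w P T := by
  obtain ⟨P, hP⟩ := p.existsP
  obtain ⟨T, hT⟩ := p.existsT hP
  have t12 := hT
  have t13 := p.T13 hT
  have t31 := p.T31 hP hT
  have t32 := p.rot.rot.T13 t31
  have t23 := p.rot.rot.T31 hP t31
  have t21 := p.rot.T13 t23
  have hPc := p.Pcomm hP
  have hTa : ∀ a b, T a b = - T b a := fun a b => p.rot.rot.i1 (by
    rw [← t12, p.kv.comm, t21, map_neg])
  have K := fun a b z => p.kv.jordan (B0 a) (B1 b) (B3 w) z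
  have hw3 : ∀ b, L (B1 b) (B3 w) = 0 := fun b => by rw [p.kv.comm, p.s31]
  have K' : ∀ a b z, (L (B1 b) (L (B3 a) z) - L (B3 a) (L (B1 b) z)) +
      (L (B3 w) (L (B1 (P a b)) z) - L (B1 (P a b)) (L (B3 w) z)) = 0 := by
    intro a b z
    have := K a b z
    rw [hw3, p.s30, p.L01 hP] at this
    simpa using this
  have I1 : ∀ a b c, T (P a b) c = T a (P b c) + T b (P a c) := by
    intro a b c
    have := K' a b (B0 c)
    rw [p.rot.rot.L10 hP, p.L10 hP, p.L10 hP, p.s30, t13, t31, p.s31, t13] at this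
    have := p.rot.i1 (a := - T b (P a c) - T a (P b c) + T (P a b) c) (b := 0) (by
      rw [map_add, map_sub, map_neg, map_zero, ← this]; simp)
    rw [← sub_eq_zero, ← this]; abel
  have R : ∀ a b c, P b (P a c) - P (P a b) c = T a (T b c) := by
    intro a b c
    have := K' a b (B3 c)
    rw [p.rot.rot.L11 hP, p.L10 hP, p.s33, p.L10 hP, t13, t13, map_neg, t32, map_neg, p.s32] at this
    have h2 := p.i1 (a := P b (P a c) - T a (T b c) - P (P a b) c) (b := 0) (by
      rw [map_sub, map_sub, map_zero, ← this]; simp; abel)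
    rw [← sub_eq_zero, ← h2]; abel
  have I2 : ∀ a b c, T (P a b) c = P a (T b c) + P b (T a c) := by
    intro a b c
    have := K' a b (B2 c)
    rw [t32, t12, t12, p.s32, p.s33, map_neg, p.L11 hP, p.rot.rot.L11 hP] at this
    have h2 := p.i0 (a := - P b (T a c) - P a (T b c) + T (P a b) c) (b := 0) (by
      rw [map_add, map_sub, map_neg, map_zero, ← this]; simp)
    rw [← sub_eq_zero, ← h2]; abel
  refine ⟨P, T, hP, hPc, hTa, fun a => p.i0 ?_, fun a => p.rot.rot.i1 ?_, fun a b c => ?_,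
    fun a b c => ?_, fun a b c => ?_, fun a b c => ?_⟩
  · rw [← hP, p.unit_left]
  · rw [← hT, p.s12, map_zero]
  · have := p.kv.sym (B0 a) (B0 b) (B0 c)
    rw [hP, hP, p.n0, p.n0] at this; linarith
  · have := p.kv.sym (B1 a) (B2 b) (B3 c)
    rw [t12, t13, p.n3, inner_neg_right, p.n2] at this; linarith
  · have e1 := R b a c
    have e2 := R a b c
    have e3 := R c a b
    have e4 : T (T a b) c = - T c (T a b) := hTa _ _
    rw [hPc c b, hPc c a, hPc (P a c) b] at e3
    rw [hPc b a] at e1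
    rw [e4, ← e3, ← e2]; abel
  · have e1 := I1 a b c
    have e2 := I2 a c b
    rw [hTa (P a c) b, hTa c b, map_neg, hPc c] at e2
    have e3 : T b (P a c) = P a (T b c) - P (T a b) c := by
      rw [← neg_inj, e2]; abel
    rw [e1, e3]; abel

end Pa

end Alg

end QK

namespace QK

open Filter Topology

section Fin

variable {E : Type*} [NormedAddCommGroup E] [InnerProductSpace ℝ E] [FiniteDimensional ℝ E]
  {w : E} {P T : E →ₗ[ℝ] E →ₗ[ℝ] E} {CE : Set E} {A : Type*} [CStarAlgebra A] {φ : E →ₗ[ℝ] A}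

lemma hasSum_ev {F : Type*} [NormedAddCommGroup F] [NormedSpace ℝ F] (φ : E →ₗ[ℝ] F) (w : E)
    {f : ℕ → E →L[ℝ] E} {g : E →L[ℝ] E} (h : HasSum f g) :
    HasSum (fun n => φ (f n w)) (φ (g w)) := by
  have h1 := (ContinuousLinearMap.apply ℝ E w).hasSum h
  have h2 := (LinearMap.toContinuousLinearMap φ).hasSum h1
  simpa using h2

lemma exp_phi (hj : JA w P T) (hφw : φ w = 1)
    (hmul : ∀ a b, φ a * φ b = φ (P a b) - Complex.I • φ (T a b)) (a : E) :
    φ (NormedSpace.exp (LinearMap.toContinuousLinearMap (P a)) w) = NormedSpace.exp (φ a) := by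
  have hpow : ∀ n : ℕ, φ (((LinearMap.toContinuousLinearMap (P a)) ^ n) w) = φ a ^ n := by
    intro n
    induction n with
    | zero => simpa using hφw
    | succ n ih =>
      set q := ((LinearMap.toContinuousLinearMap (P a)) ^ n) w with hq
      have h1 := hmul a q
      have h2 := hmul q a
      rw [ih] at h1 h2
      have h3 : φ a * φ a ^ n = φ a ^ n * φ a := (pow_succ' _ _).symm.trans (pow_succ _ _)
      have h4 : (2 * Complex.I) • φ (T a q) = 0 := by
        have : φ (P a q) - Complex.I • φ (T a q) = φ (P a q) + Complex.I • φ (T a q) := by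
          rw [← h1, h3, h2, hj.pcomm q a, hj.tanti q a]; simp
        rw [mul_smul, two_smul]
        have h5 := sub_eq_zero.2 this
        rw [← neg_eq_zero, ← h5]; abel
      have h5 := (smul_eq_zero.1 h4).resolve_left (by simp)
      rw [h5, smul_zero, sub_zero] at h1
      rw [pow_succ' (φ a), h1, pow_succ', mul_apply_eq_comp]
      rfl
  have s1 := NormedSpace.exp_series_hasSum_exp' (𝕂 := ℝ) (LinearMap.toContinuousLinearMap (P a))
  have s2 : HasSum (fun n : ℕ => φ ((((n.factorial : ℝ))⁻¹ •
      (LinearMap.toContinuousLinearMap (P a)) ^ n) w))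
      (φ (NormedSpace.exp (LinearMap.toContinuousLinearMap (P a)) w)) := by
    exact hasSum_ev φ w s1
  have s3 := NormedSpace.exp_series_hasSum_exp' (𝕂 := ℝ) (φ a)
  refine s2.unique ?_
  convert s3 using 2 with n
  rw [_root_.smul_apply, map_smul, hpow]

lemma cone_image (hsd : SD CE) (hj : JA w P T)
    (hexp : ∀ a, NormedSpace.exp (LinearMap.toContinuousLinearMap (P a)) w ∈ CE)
    (hinj : Function.Injective φ) (hr : Set.range φ = {a : A | IsSelfAdjoint a})
    (hφw : φ w = 1)
    (hmul : ∀ a b, φ a * φ b = φ (P a b) - Complex.I • φ (T a b)) :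
    φ '' CE = {a : A | IsSelfAdjoint a ∧ ∃ b : A, a = star b * b} := by
  let _ : PartialOrder A := CStarAlgebra.spectralOrder A
  have _ : StarOrderedRing A := CStarAlgebra.spectralOrderedRing A
  have hsa : ∀ a, IsSelfAdjoint (φ a) := fun a => by
    have : φ a ∈ Set.range φ := ⟨a, rfl⟩
    rw [hr] at this; exact this
  have hex : ∀ x : A, IsSelfAdjoint x → ∃ a, φ a = x := fun x hx => by
    have : x ∈ {a : A | IsSelfAdjoint a} := hx
    rw [← hr] at this; exact this
  have key1 : ∀ c, 0 ≤ φ c → c ∈ CE := by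
    intro c hc
    have hε : ∀ ε : ℝ, 0 < ε → c + ε • w ∈ CE := by
      intro ε hε
      have hp : IsStrictlyPositive (φ (c + ε • w)) := by
        rw [map_add, map_smul, hφw]
        exact IsStrictlyPositive.nonneg_add hc (IsStrictlyPositive.smul hε isStrictlyPositive_one)
      obtain ⟨a, ha⟩ := hex _ (IsSelfAdjoint.log (a := φ (c + ε • w)))
      have h1 := CFC.exp_log (φ (c + ε • w)) hp
      rw [← ha, ← exp_phi hj hφw hmul] at h1
      rw [← hinj h1]
      exact hexp a
    have hl : Tendsto (fun ε : ℝ => c + ε • w) (𝓝[>] 0) (𝓝 (c + (0 : ℝ) • w)) :=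
      Tendsto.mono_left (Continuous.tendsto (by fun_prop) 0) nhdsWithin_le_nhds
    rw [zero_smul, add_zero] at hl
    exact hsd.closed.mem_of_tendsto hl (by
      filter_upwards [self_mem_nhdsWithin] with ε h using hε ε h)
  have key2 : ∀ c ∈ CE, 0 ≤ φ c := by
    intro c hc
    obtain ⟨p, hp⟩ := hex _ (CFC.posPart_nonneg (φ c)).isSelfAdjoint
    obtain ⟨n, hn⟩ := hex _ (CFC.negPart_nonneg (φ c)).isSelfAdjoint
    have h1 := CFC.posPart_sub_negPart (φ c) (hsa c)
    have h2 := CFC.posPart_mul_negPart (φ c)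
    have h3 := CFC.negPart_mul_posPart (φ c)
    rw [← hp, ← hn] at h1 h2 h3
    have hnC : n ∈ CE := key1 n (by rw [hn]; exact CFC.negPart_nonneg _)
    rw [hmul] at h2 h3
    rw [hj.pcomm n p, hj.tanti n p] at h3
    have h4 : (2 : ℝ) • φ (P p n) = 0 := by
      rw [two_smul]
      have := congrArg₂ (· + ·) h2 h3
      simpa using this
    have h5 : P p n = 0 := hinj (by
      rw [map_zero]; exact (smul_eq_zero.1 h4).resolve_left (by norm_num))
    have h6 : ⟪p, n⟫ = 0 := by
      have := hj.psym p w n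
      rw [hj.pcomm p w, hj.pw, h5] at this
      simpa using this
    have h7 : c = p - n := hinj (by rw [← h1, map_sub])
    have h8 := hsd.nonneg hc hnC
    rw [h7, inner_sub_left, h6, real_inner_self_eq_norm_sq] at h8
    have h9 : n = 0 := by
      have : ‖n‖ ^ 2 = 0 := le_antisymm (by linarith) (by positivity)
      simpa using this
    rw [h7, h9, sub_zero, hp]
    exact CFC.posPart_nonneg _
  ext x
  constructor
  · rintro ⟨c, hc, rfl⟩
    exact ⟨hsa c, CStarAlgebra.nonneg_iff_eq_star_mul_self.1 (key2 c hc)⟩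
  · rintro ⟨hx, b, hb⟩
    obtain ⟨c, rfl⟩ := hex x hx
    exact ⟨c, key1 c (CStarAlgebra.nonneg_iff_eq_star_mul_self.2 ⟨b, hb⟩), rfl⟩

end Fin

end QK

namespace QK

open Filter Topology

section Mat

variable {E : Type*} [NormedAddCommGroup E] [InnerProductSpace ℝ E] [FiniteDimensional ℝ E]
  {w : E} {P T : E →ₗ[ℝ] E →ₗ[ℝ] E}

/-- complex matrix of a real endomorphism -/
def J : (E →ₗ[ℝ] E) →ₗ[ℝ] Matrix (Fin (Module.finrank ℝ E)) (Fin (Module.finrank ℝ E)) ℂ where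
  toFun f := (LinearMap.toMatrixOrthonormal (stdOrthonormalBasis ℝ E) f).map Complex.ofReal
  map_add' f g := by ext; simp [LinearMap.toMatrixOrthonormal_apply_apply, inner_add_right]
  map_smul' f g := by ext; simp [LinearMap.toMatrixOrthonormal_apply_apply, inner_smul_right]

lemma J_mul (f g : E →ₗ[ℝ] E) : J (f * g) = J f * J g := by
  change (LinearMap.toMatrixOrthonormal (stdOrthonormalBasis ℝ E) (f * g)).map Complex.ofReal = _
  rw [map_mul]
  exact Matrix.map_mul (f := Complex.ofRealHom)

lemma J_one : J (1 : E →ₗ[ℝ] E) = 1 := by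
  change (LinearMap.toMatrixOrthonormal (stdOrthonormalBasis ℝ E) 1).map Complex.ofReal = _
  rw [map_one]
  exact Matrix.map_one _ (by simp) (by simp)

lemma J_star (f : E →ₗ[ℝ] E) : star (J f) = J (LinearMap.adjoint f) := by
  ext i j
  change star ((LinearMap.toMatrixOrthonormal (stdOrthonormalBasis ℝ E) f j i : ℝ) : ℂ) =
    ((LinearMap.toMatrixOrthonormal (stdOrthonormalBasis ℝ E) (LinearMap.adjoint f) i j : ℝ) : ℂ)
  rw [LinearMap.toMatrixOrthonormal_apply_apply, LinearMap.toMatrixOrthonormal_apply_apply,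
    LinearMap.adjoint_inner_right, real_inner_comm]
  exact Complex.conj_ofReal _

lemma J_indep {f g : E →ₗ[ℝ] E} (h : J f + Complex.I • J g = 0) : f = 0 ∧ g = 0 := by
  have h1 : ∀ i j, (LinearMap.toMatrixOrthonormal (stdOrthonormalBasis ℝ E) f i j = 0) ∧
      (LinearMap.toMatrixOrthonormal (stdOrthonormalBasis ℝ E) g i j = 0) := by
    intro i j
    have h2 := congrArg (fun M => M i j) h
    simp only [J, Matrix.add_apply, Matrix.smul_apply, LinearMap.coe_mk, AddHom.coe_mk,
      Matrix.map_apply, Matrix.zero_apply, smul_eq_mul] at h2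
    have h3 := congrArg Complex.re h2
    have h4 := congrArg Complex.im h2
    simp at h3 h4
    exact ⟨h3, h4⟩
  constructor
  · apply (LinearMap.toMatrixOrthonormal (stdOrthonormalBasis ℝ E)).injective
    rw [map_zero]; ext i j; exact (h1 i j).1
  · apply (LinearMap.toMatrixOrthonormal (stdOrthonormalBasis ℝ E)).injective
    rw [map_zero]; ext i j; exact (h1 i j).2

/-- the representation -/
def rep (P T : E →ₗ[ℝ] E →ₗ[ℝ] E) (a : E) :
    Matrix (Fin (Module.finrank ℝ E)) (Fin (Module.finrank ℝ E)) ℂ := J (P a) - Complex.I • J (T a)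

lemma rep_add (a b : E) : rep P T (a + b) = rep P T a + rep P T b := by
  simp only [rep, map_add, smul_add]; abel

lemma rep_smul (r : ℝ) (a : E) : rep P T (r • a) = r • rep P T a := by
  simp only [rep, map_smul, smul_sub, smul_comm r Complex.I]

lemma rep_neg (a : E) : rep P T (-a) = - rep P T a := by
  simp only [rep, map_neg, smul_neg]; abel

lemma rep_sub (a b : E) : rep P T (a - b) = rep P T a - rep P T b := by
  rw [sub_eq_add_neg, rep_add, rep_neg, sub_eq_add_neg]

lemma I_smul_I {M : Type*} [AddCommGroup M] [Module ℂ M] (x : M) :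
    Complex.I • Complex.I • x = - x := by rw [smul_smul, Complex.I_mul_I, neg_one_smul]

lemma rep_mul (hj : JA w P T) (a b : E) :
    rep P T a * rep P T b = rep P T (P a b) - Complex.I • rep P T (T a b) := by
  have h1 : P a * P b - T a * T b = P (P a b) - T (T a b) := LinearMap.ext fun c => hj.re a b c
  have h2 : P a * T b + T a * P b = T (P a b) + P (T a b) := LinearMap.ext fun c => hj.im a b c
  have h3 := congrArg J h1
  have h4 := congrArg J h2
  simp only [map_sub, map_add, J_mul] at h3 h4
  simp only [rep, sub_mul, mul_sub, smul_mul_assoc, mul_smul_comm, smul_sub, I_smul_I]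
  have : J (P a) * J (P b) - Complex.I • (J (T a) * J (P b)) -
      (Complex.I • (J (P a) * J (T b)) - -(J (T a) * J (T b))) =
      (J (P a) * J (P b) - J (T a) * J (T b)) -
      Complex.I • (J (P a) * J (T b) + J (T a) * J (P b)) := by rw [smul_add]; abel
  rw [this, h3, h4, smul_add]; abel

lemma rep_star (hj : JA w P T) (a : E) : star (rep P T a) = rep P T a := by
  have h1 : LinearMap.adjoint (P a) = P a := ((LinearMap.eq_adjoint_iff _ _).2 (hj.psym a)).symm
  have h2 : LinearMap.adjoint (T a) = - T a :=
    ((LinearMap.eq_adjoint_iff _ _).2 (fun x y => by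
      rw [LinearMap.neg_apply, inner_neg_left, hj.tskew, neg_neg])).symm
  simp only [rep, star_sub, star_smul, J_star, h1, h2, map_neg]
  simp

lemma rep_one (hj : JA w P T) : rep P T w = 1 := by
  have h1 : P w = 1 := LinearMap.ext fun a => hj.pw a
  have h2 : T w = 0 := LinearMap.ext fun a => hj.tw a
  rw [rep, h1, h2, J_one]; simp

lemma rep_indep (hj : JA w P T) {a b : E} (h : rep P T a + Complex.I • rep P T b = 0) :
    a = 0 ∧ b = 0 := by
  have h1 : J (P a + T b) + Complex.I • J (P b - T a) = 0 := by
    rw [← h]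
    simp only [rep, map_add, map_sub, smul_sub, I_smul_I]; abel
  obtain ⟨h2, h3⟩ := J_indep h1
  have h4 := congrArg (fun f : E →ₗ[ℝ] E => f w) h2
  have h5 := congrArg (fun f : E →ₗ[ℝ] E => f w) h3
  simp only [LinearMap.add_apply, LinearMap.sub_apply, hj.pcomm _ w, hj.tanti _ w, hj.pw, hj.tw,
    LinearMap.zero_apply, neg_zero, add_zero, sub_zero] at h4 h5
  exact ⟨h4, h5⟩

/-- the enveloping algebra -/
def alg (hj : JA w P T) :
    StarSubalgebra ℂ (Matrix (Fin (Module.finrank ℝ E)) (Fin (Module.finrank ℝ E)) ℂ) where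
  carrier := {x | ∃ a b, x = rep P T a + Complex.I • rep P T b}
  mul_mem' := by
    rintro _ _ ⟨a, b, rfl⟩ ⟨c, d, rfl⟩
    refine ⟨P a c - P b d + (T a d + T b c), P a d + P b c - T a c + T b d, ?_⟩
    simp only [add_mul, mul_add, smul_mul_assoc, mul_smul_comm, rep_mul hj, rep_add, rep_sub,
      smul_sub, smul_add, smul_neg, I_smul_I]
    abel
  add_mem' := by
    rintro _ _ ⟨a, b, rfl⟩ ⟨c, d, rfl⟩
    exact ⟨a + c, b + d, by simp only [rep_add, smul_add]; abel⟩
  algebraMap_mem' := by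
    intro r
    refine ⟨r.re • w, r.im • w, ?_⟩
    rw [rep_smul, rep_smul, rep_one hj, Algebra.algebraMap_eq_smul_one]
    ext i j
    simp only [Matrix.smul_apply, Matrix.add_apply, Complex.real_smul, smul_eq_mul]
    conv_lhs => rw [← Complex.re_add_im r]
    ring
  star_mem' := by
    rintro _ ⟨a, b, rfl⟩
    refine ⟨a, -b, ?_⟩
    rw [rep_neg, star_add, star_smul, rep_star hj, rep_star hj]
    simp

open scoped Matrix.Norms.L2Operator

lemma exists_alg (hj : JA w P T) : ∃ (A : Type) (_ : CStarAlgebra A) (_ : FiniteDimensional ℂ A)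
    (φ : E →ₗ[ℝ] A), Function.Injective φ ∧ Set.range φ = {a : A | IsSelfAdjoint a} ∧ φ w = 1 ∧
    ∀ a b, φ a * φ b = φ (P a b) - Complex.I • φ (T a b) := by
  have hcl : IsClosed (alg hj : Set (Matrix (Fin (Module.finrank ℝ E))
      (Fin (Module.finrank ℝ E)) ℂ)) :=
    Submodule.closed_of_finiteDimensional (alg hj).toSubalgebra.toSubmodule
  let _ : CStarAlgebra (alg hj) := StarSubalgebra.cstarAlgebra (alg hj)
  have hfd : FiniteDimensional ℂ (alg hj) :=
    inferInstanceAs (FiniteDimensional ℂ (alg hj).toSubalgebra.toSubmodule)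
  refine ⟨alg hj, inferInstance, hfd,
    { toFun := fun a => ⟨rep P T a, a, 0, by simp [rep]⟩
      map_add' := fun a b => Subtype.ext (rep_add a b)
      map_smul' := fun r a => Subtype.ext (rep_smul r a) }, ?_, ?_, ?_, ?_⟩
  · intro a b h
    have h1 : rep P T a = rep P T b := congrArg Subtype.val h
    have h2 := (rep_indep hj (a := a - b) (b := 0) (by rw [rep_sub, h1]; simp [rep])).1
    exact sub_eq_zero.1 h2
  · ext x
    constructor
    · rintro ⟨a, rfl⟩
      exact Subtype.ext (rep_star hj a)
    · intro hx
      obtain ⟨x, a, b, rfl⟩ := x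
      have h1 : star (rep P T a + Complex.I • rep P T b) = rep P T a + Complex.I • rep P T b :=
        congrArg Subtype.val hx
      rw [star_add, star_smul, rep_star hj, rep_star hj] at h1
      have h2 := (rep_indep hj (a := 0) (b := b + b) (by
        rw [rep_add]
        have := sub_eq_zero.2 h1.symm
        rw [← this]
        simp [rep])).2
      have h3 : b = 0 := by
        rw [← two_smul ℝ] at h2
        exact (smul_eq_zero.1 h2).resolve_left two_ne_zero
      refine ⟨a, Subtype.ext ?_⟩
      rw [h3]; simp [rep]
  · exact Subtype.ext (rep_one hj)
  · intro a b
    exact Subtype.ext (rep_mul hj a b)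

end Mat

end QK

namespace QK

section Pauli

/-- conjugation by an invertible Hermitian matrix -/
def AdL (m : Matrix (Fin 2) (Fin 2) ℂ) (hm : star m = m) : QubitObservables →ₗ[ℝ] QubitObservables where
  toFun v := ⟨m * v.1 * m, by
    have := v.2
    rw [selfAdjoint.mem_iff] at this ⊢
    rw [star_mul, star_mul, hm, this, mul_assoc]⟩
  map_add' v v' := Subtype.ext (by simp [mul_add, add_mul])
  map_smul' r v := Subtype.ext (by simp)

lemma AdL_cone (m : Matrix (Fin 2) (Fin 2) ℂ) (hm : star m = m) (v : QubitObservables)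
    (hv : v ∈ qubitCone) : AdL m hm v ∈ qubitCone := by
  have h : (v.1).PosSemidef := hv
  have h2 := h.mul_mul_conjTranspose_same m
  rw [← Matrix.star_eq_conjTranspose, hm] at h2
  exact h2

lemma exists_Ad (m m' : Matrix (Fin 2) (Fin 2) ℂ) (hm : star m = m) (hm' : star m' = m')
    (h1 : m * m' = 1) (h2 : m' * m = 1) :
    ∃ h : QubitObservables ≃ₗ[ℝ] QubitObservables, h '' qubitCone = qubitCone ∧
      ∀ v, ((h v : QubitObservables) : Matrix (Fin 2) (Fin 2) ℂ) = m * v.1 * m := by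
  have e : ∀ (m m' : Matrix (Fin 2) (Fin 2) ℂ) (hm : star m = m) (hm' : star m' = m')
    (h1 : m * m' = 1) (h2 : m' * m = 1), ∀ v, AdL m hm (AdL m' hm' v) = v := by
    intro m m' hm hm' h1 h2 v
    apply Subtype.ext
    change m * (m' * v.1 * m') * m = v.1
    rw [mul_assoc m', ← mul_assoc m, h1, one_mul, mul_assoc, h2, mul_one]
  refine ⟨LinearEquiv.ofLinearMap (AdL m hm) (AdL m' hm') (LinearMap.ext fun v => e m m' hm hm' h1 h2 v)
    (LinearMap.ext fun v => e m' m hm' hm h2 h1 v), ?_, fun v => rfl⟩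
  ext v
  constructor
  · rintro ⟨v, hv, rfl⟩
    exact AdL_cone m hm v hv
  · intro hv
    exact ⟨AdL m' hm' v, AdL_cone m' hm' v hv, e m m' hm hm' h1 h2 v⟩

/-- Pauli matrices, distinguished axis first -/
structure Pauli (s1 s2 s3 : QubitObservables) : Prop where
  t0 : ((s1 : Matrix (Fin 2) (Fin 2) ℂ)).trace.re = 0
  t1 : (s1.1 * s1.1).trace.re = 2
  t2 : (s1.1 * s2.1).trace.re = 0
  t3 : (s1.1 * s3.1).trace.re = 0
  span : ∀ v : QubitObservables, ∃ a b c d : ℝ, v = a • 1 + b • s1 + c • s2 + d • s3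
  flip : ∃ h : QubitObservables ≃ₗ[ℝ] QubitObservables, h '' qubitCone = qubitCone ∧
    h 1 = 1 ∧ h s1 = s1 ∧ h s2 = - s2 ∧ h s3 = - s3
  boost : ∀ t : ℝ, |t| < 1 → ∃ h : QubitObservables ≃ₗ[ℝ] QubitObservables,
    h '' qubitCone = qubitCone ∧ h 1 = (1 + t ^ 2) • 1 + (2 * t) • s1 ∧
    h s1 = (1 + t ^ 2) • s1 + (2 * t) • 1 ∧ h s2 = (1 - t ^ 2) • s2 ∧ h s3 = (1 - t ^ 2) • s3

lemma Pauli.mk' (s1 s2 s3 : QubitObservables)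
    (h11 : s1.1 * s1.1 = 1) (h12 : s1.1 * s2.1 = - (s2.1 * s1.1)) (h13 : s1.1 * s3.1 = - (s3.1 * s1.1))
    (t0 : ((s1 : Matrix (Fin 2) (Fin 2) ℂ)).trace.re = 0)
    (span : ∀ v : QubitObservables, ∃ a b c d : ℝ, v = a • 1 + b • s1 + c • s2 + d • s3) :
    Pauli s1 s2 s3 := by
  have hs : star s1.1 = s1.1 := s1.2
  have c12 : s1.1 * s2.1 * s1.1 = - s2.1 := by rw [h12, neg_mul, mul_assoc, h11, mul_one]
  have c13 : s1.1 * s3.1 * s1.1 = - s3.1 := by rw [h13, neg_mul, mul_assoc, h11, mul_one]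
  have tr : ∀ x : Matrix (Fin 2) (Fin 2) ℂ, s1.1 * x = - (x * s1.1) → (s1.1 * x).trace.re = 0 := by
    intro x hx
    have h := congrArg (fun M => M.trace.re) hx
    simp only [Matrix.trace_neg, Complex.neg_re, Matrix.trace_mul_comm x] at h
    linarith
  refine ⟨t0, by rw [h11]; simp, tr _ h12, tr _ h13, span, ?_, ?_⟩
  · obtain ⟨h, hc, hh⟩ := exists_Ad s1.1 s1.1 hs hs h11 h11
    refine ⟨h, hc, Subtype.ext ?_, Subtype.ext ?_, Subtype.ext ?_, Subtype.ext ?_⟩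
    · rw [hh]; simp [h11]
    · rw [hh, h11, one_mul]
    · rw [hh, c12]; simp
    · rw [hh, c13]; simp
  · intro t ht
    have ht2 : (1 - t ^ 2 : ℝ) ≠ 0 := by
      have := (sq_lt_one_iff_abs_lt_one t).2 ht
      linarith
    have e1 : (1 + t • s1.1) * (1 - t • s1.1) = (1 - t ^ 2) • (1 : Matrix (Fin 2) (Fin 2) ℂ) := by
      simp only [add_mul, mul_sub, one_mul, mul_one, smul_mul_assoc, mul_smul_comm, h11]
      module
    have e2 : (1 - t • s1.1) * (1 + t • s1.1) = (1 - t ^ 2) • (1 : Matrix (Fin 2) (Fin 2) ℂ) := by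
      simp only [sub_mul, mul_add, one_mul, mul_one, smul_mul_assoc, mul_smul_comm, h11]
      module
    obtain ⟨h, hc, hh⟩ := exists_Ad (1 + t • s1.1) ((1 - t ^ 2)⁻¹ • (1 - t • s1.1))
      (by rw [star_add, star_smul, hs]; simp)
      (by rw [star_smul, star_sub, star_smul, hs]; simp)
      (by rw [mul_smul_comm, e1, smul_smul, inv_mul_cancel₀ ht2, one_smul])
      (by rw [smul_mul_assoc, e2, smul_smul, inv_mul_cancel₀ ht2, one_smul])
    refine ⟨h, hc, Subtype.ext ?_, Subtype.ext ?_, Subtype.ext ?_, Subtype.ext ?_⟩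
    · rw [hh]
      change (1 + t • s1.1) * 1 * (1 + t • s1.1) =
        (1 + t ^ 2) • (1 : Matrix (Fin 2) (Fin 2) ℂ) + (2 * t) • s1.1
      simp only [add_mul, mul_add, one_mul, mul_one, smul_mul_assoc, mul_smul_comm, h11]
      module
    · rw [hh]
      change (1 + t • s1.1) * s1.1 * (1 + t • s1.1) =
        (1 + t ^ 2) • s1.1 + (2 * t) • (1 : Matrix (Fin 2) (Fin 2) ℂ)
      simp only [add_mul, mul_add, one_mul, mul_one, smul_mul_assoc, mul_smul_comm, h11]
      module
    · rw [hh]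
      change (1 + t • s1.1) * s2.1 * (1 + t • s1.1) = (1 - t ^ 2) • s2.1
      simp only [add_mul, mul_add, one_mul, mul_one, smul_mul_assoc, mul_smul_comm, c12]
      rw [h12]
      module
    · rw [hh]
      change (1 + t • s1.1) * s3.1 * (1 + t • s1.1) = (1 - t ^ 2) • s3.1
      simp only [add_mul, mul_add, one_mul, mul_one, smul_mul_assoc, mul_smul_comm, c13]
      rw [h13]
      module

lemma exists_pauli : ∃ s1 s2 s3 : QubitObservables, Pauli s1 s2 s3 ∧ Pauli s2 s3 s1 ∧
    Pauli s3 s1 s2 := by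
  let s1 : QubitObservables := ⟨!![0, 1; 1, 0], by
    rw [selfAdjoint.mem_iff]; ext i j; fin_cases i <;> fin_cases j <;> simp [Matrix.star_apply]⟩
  let s2 : QubitObservables := ⟨!![0, -Complex.I; Complex.I, 0], by
    rw [selfAdjoint.mem_iff]; ext i j; fin_cases i <;> fin_cases j <;> simp [Matrix.star_apply]⟩
  let s3 : QubitObservables := ⟨!![1, 0; 0, -1], by
    rw [selfAdjoint.mem_iff]; ext i j; fin_cases i <;> fin_cases j <;> simp [Matrix.star_apply]⟩
  have span : ∀ v : QubitObservables, ∃ a b c d : ℝ, v = a • 1 + b • s1 + c • s2 + d • s3 := by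
    intro v
    have hv : star v.1 = v.1 := v.2
    have e00 := congrArg (fun M => (M 0 0).im) hv
    have e11 := congrArg (fun M => (M 1 1).im) hv
    have e10 := congrArg (fun M => (M 1 0)) hv
    simp only [Matrix.star_apply, RCLike.star_def, Complex.conj_im] at e00 e11 e10
    refine ⟨((v.1 0 0).re + (v.1 1 1).re) / 2, (v.1 0 1).re, - (v.1 0 1).im,
      ((v.1 0 0).re - (v.1 1 1).re) / 2, Subtype.ext ?_⟩
    change v.1 = (((v.1 0 0).re + (v.1 1 1).re) / 2) • (1 : Matrix (Fin 2) (Fin 2) ℂ) +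
      (v.1 0 1).re • !![0, 1; 1, 0] + (- (v.1 0 1).im) • !![0, -Complex.I; Complex.I, 0] +
      (((v.1 0 0).re - (v.1 1 1).re) / 2) • !![1, 0; 0, -1]
    ext i j
    fin_cases i <;> fin_cases j
    · apply Complex.ext <;> simp
      · ring
      · linarith
    · apply Complex.ext <;> simp
    · simp only [Fin.mk_one, Fin.zero_eta, ← e10]
      apply Complex.ext <;> simp
    · apply Complex.ext <;> simp
      · ring
      · linarith
  have h11 : s1.1 * s1.1 = 1 := by
    ext i j; fin_cases i <;> fin_cases j <;> simp [s1, Matrix.mul_apply]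
  have h22 : s2.1 * s2.1 = 1 := by
    ext i j; fin_cases i <;> fin_cases j <;> simp [s2, Matrix.mul_apply]
  have h33 : s3.1 * s3.1 = 1 := by
    ext i j; fin_cases i <;> fin_cases j <;> simp [s3, Matrix.mul_apply]
  have h12 : s1.1 * s2.1 = - (s2.1 * s1.1) := by
    ext i j; fin_cases i <;> fin_cases j <;> simp [s1, s2, Matrix.mul_apply]
  have h23 : s2.1 * s3.1 = - (s3.1 * s2.1) := by
    ext i j; fin_cases i <;> fin_cases j <;> simp [s2, s3, Matrix.mul_apply]
  have h31 : s3.1 * s1.1 = - (s1.1 * s3.1) := by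
    ext i j; fin_cases i <;> fin_cases j <;> simp [s1, s3, Matrix.mul_apply]
  refine ⟨s1, s2, s3, Pauli.mk' _ _ _ h11 h12 (by rw [h31, neg_neg]) ?_ span,
    Pauli.mk' _ _ _ h22 h23 (by rw [h12, neg_neg]) ?_ ?_,
    Pauli.mk' _ _ _ h33 h31 (by rw [h23, neg_neg]) ?_ ?_⟩
  · simp [s1, Matrix.trace_fin_two]
  · simp [s2, Matrix.trace_fin_two]
  · intro v
    obtain ⟨a, b, c, d, h⟩ := span v
    exact ⟨a, c, d, b, by rw [h]; abel⟩
  · simp [s3, Matrix.trace_fin_two]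
  · intro v
    obtain ⟨a, b, c, d, h⟩ := span v
    exact ⟨a, d, b, c, by rw [h]; abel⟩

end Pauli

end QK

namespace QK

section Setup

variable {E V : Type*} [NormedAddCommGroup E] [InnerProductSpace ℝ E] [FiniteDimensional ℝ E]
  [NormedAddCommGroup V] [InnerProductSpace ℝ V] [FiniteDimensional ℝ V]
  {CV : Set V} {B0 B1 B2 B3 : E →ₗ[ℝ] V}

/-- orthogonal Pauli decomposition of the composite -/
structure Dec (CV : Set V) (B0 B1 B2 B3 : E →ₗ[ℝ] V) : Prop where
  span : ∀ z, ∃ a b c d, z = B0 a + B1 b + B2 c + B3 d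
  inn : ∀ a b c d a' b' c' d', ⟪B0 a + B1 b + B2 c + B3 d, B0 a' + B1 b' + B2 c' + B3 d'⟫ =
    2 * (⟪a, a'⟫ + ⟪b, b'⟫ + ⟪c, c'⟫ + ⟪d, d'⟫)
  flip : ∃ H : V ≃ₗ[ℝ] V, H '' CV = CV ∧ (∀ a, H (B0 a) = B0 a) ∧ (∀ a, H (B1 a) = B1 a) ∧
    (∀ a, H (B2 a) = - B2 a) ∧ (∀ a, H (B3 a) = - B3 a)
  boost : ∀ t : ℝ, |t| < 1 → ∃ H : V ≃ₗ[ℝ] V, H '' CV = CV ∧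
    (∀ a, H (B0 a) = (1 + t ^ 2) • B0 a + (2 * t) • B1 a) ∧
    (∀ a, H (B1 a) = (1 + t ^ 2) • B1 a + (2 * t) • B0 a) ∧
    (∀ a, H (B2 a) = (1 - t ^ 2) • B2 a) ∧ (∀ a, H (B3 a) = (1 - t ^ 2) • B3 a)

lemma Dec.inj (D : Dec CV B0 B1 B2 B3) (a b c d : E) (h : B0 a + B1 b + B2 c + B3 d = 0) :
    a = 0 ∧ b = 0 ∧ c = 0 ∧ d = 0 := by
  have h1 := D.inn a b c d a b c d
  rw [h, inner_zero_left] at h1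
  simp only [real_inner_self_eq_norm_sq] at h1
  have := sq_nonneg ‖a‖
  have := sq_nonneg ‖b‖
  have := sq_nonneg ‖c‖
  have := sq_nonneg ‖d‖
  refine ⟨?_, ?_, ?_, ?_⟩ <;> rw [← norm_eq_zero, ← sq_eq_zero_iff] <;> linarith

/-- fixed vectors of the flip -/
lemma Dec.fixed (D : Dec CV B0 B1 B2 B3) {u : V}
    (hfix : ∀ g g' : V →L[ℝ] V, IsAut CV g g' → (∀ x, ‖g x‖ = ‖x‖) → g u = u)
    {a b c d : E} (hu : u = B0 a + B1 b + B2 c + B3 d) : c = 0 ∧ d = 0 := by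
  obtain ⟨H, hH, h0, h1, h2, h3⟩ := D.flip
  have hap : ∀ a b c d, H (B0 a + B1 b + B2 c + B3 d) = B0 a + B1 b + B2 (-c) + B3 (-d) := by
    intro a b c d
    simp only [map_add, map_neg, h0, h1, h2, h3]
  have := hfix _ _ (IsAut.ofEquiv H hH) (fun x => by
    obtain ⟨a, b, c, d, rfl⟩ := D.span x
    have e : ‖H (B0 a + B1 b + B2 c + B3 d)‖ ^ 2 = ‖B0 a + B1 b + B2 c + B3 d‖ ^ 2 := by
      rw [hap, ← real_inner_self_eq_norm_sq, ← real_inner_self_eq_norm_sq, D.inn, D.inn]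
      simp
    exact (sq_eq_sq₀ (norm_nonneg _) (norm_nonneg _)).1 e)
  have h4 : H u = u := this
  rw [hu, hap] at h4
  have h5 := D.inj 0 0 (c + c) (d + d) (by
    have h6 := sub_eq_zero.2 h4.symm
    rw [← h6]; simp only [map_zero, map_add, map_neg]; abel)
  have h7 : ∀ x : E, x + x = 0 → x = 0 := fun x hx => by
    rw [← two_smul ℝ] at hx
    exact (smul_eq_zero.1 hx).resolve_left two_ne_zero
  exact ⟨h7 _ h5.2.2.1, h7 _ h5.2.2.2⟩

lemma aux_real {m k : ℝ} (h : ∀ t : ℝ, |t| < 1 → 0 ≤ 2 * t * m - 2 * t ^ 2 * k) : m = 0 := by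
  by_contra hm
  have hm' : 0 < |m| := abs_pos.2 hm
  set t : ℝ := |m| / (|m| + |k| + 1) with ht
  have hk := abs_nonneg k
  have hpos : 0 < |m| + |k| + 1 := by positivity
  have ht0 : 0 < t := by positivity
  have ht1 : t < 1 := by rw [ht, div_lt_one hpos]; linarith
  have e1 := h t (by rw [abs_of_pos ht0]; exact ht1)
  have e2 := h (-t) (by rw [abs_neg, abs_of_pos ht0]; exact ht1)
  have f1 : t * k ≤ m := by
    have : 0 ≤ 2 * t * (m - t * k) := by nlinarith
    have := nonneg_of_mul_nonneg_right this (by positivity)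
    linarith
  have f2 : t * k ≤ - m := by
    have : 0 ≤ 2 * t * (- m - t * k) := by nlinarith
    have := nonneg_of_mul_nonneg_right this (by positivity)
    linarith
  have f3 : |m| ≤ - (t * k) := by
    rcases abs_cases m with ⟨h1, _⟩ | ⟨h1, _⟩ <;> rw [h1] <;> linarith
  have f4 : - (t * k) ≤ t * |k| := by
    have := neg_abs_le k
    nlinarith
  have f5 : t * |k| < |m| := by
    rw [ht, div_mul_eq_mul_div, div_lt_iff₀ hpos]
    nlinarith
  linarith

lemma Dec.lyap (D : Dec CV B0 B1 B2 B3) (h : SD CV) : ∃ M : V →L[ℝ] V, Lyap CV M ∧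
    (∀ x y, ⟪M x, y⟫ = ⟪x, M y⟫) ∧ (∀ a, M (B0 a) = B1 a) ∧ (∀ a, M (B1 a) = B0 a) ∧
    (∀ a, M (B2 a) = 0) ∧ (∀ a, M (B3 a) = 0) := by
  obtain ⟨H, -, p0, p1, p2, p3⟩ := D.boost (1 / 2) (by norm_num [abs_of_pos])
  obtain ⟨H', -, q0, q1, q2, q3⟩ := D.boost (-(1 / 2)) (by rw [abs_neg]; norm_num [abs_of_pos])
  let M : V →L[ℝ] V := LinearMap.toContinuousLinearMap ((1 / 2 : ℝ) • (H.toLinearMap - H'.toLinearMap))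
  have hM : ∀ z, M z = (1 / 2 : ℝ) • (H z - H' z) := fun z => rfl
  have m0 : ∀ a, M (B0 a) = B1 a := fun a => by rw [hM, p0, q0]; module
  have m1 : ∀ a, M (B1 a) = B0 a := fun a => by rw [hM, p1, q1]; module
  have m2 : ∀ a, M (B2 a) = 0 := fun a => by rw [hM, p2, q2]; module
  have m3 : ∀ a, M (B3 a) = 0 := fun a => by rw [hM, p3, q3]; module
  have hap : ∀ a b c d, M (B0 a + B1 b + B2 c + B3 d) = B0 b + B1 a + B2 0 + B3 0 := by
    intro a b c d
    simp only [map_add, m0, m1, m2, m3, map_zero]; abel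
  refine ⟨M, ?_, ?_, m0, m1, m2, m3⟩
  · intro x hx y hy hxy
    obtain ⟨a, b, c, d, hx'⟩ := D.span x
    refine aux_real (k := ⟪B2 c + B3 d, y⟫) fun t ht => ?_
    obtain ⟨G, hG, g0, g1, g2, g3⟩ := D.boost t ht
    have h1 : G x ∈ CV := by rw [← hG]; exact ⟨x, hx, rfl⟩
    have h2 := h.nonneg h1 hy
    have h3 : G x = (1 + t ^ 2) • x + (2 * t) • M x - (2 * t ^ 2) • (B2 c + B3 d) := by
      rw [hx', hap]
      simp only [map_add, g0, g1, g2, g3, map_zero]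
      module
    rw [h3, inner_sub_left, inner_add_left, real_inner_smul_left, real_inner_smul_left,
      real_inner_smul_left, hxy] at h2
    linarith
  · intro x y
    obtain ⟨a, b, c, d, rfl⟩ := D.span x
    obtain ⟨a', b', c', d', rfl⟩ := D.span y
    rw [hap, hap, D.inn, D.inn]
    simp only [inner_zero_left, inner_zero_right]; ring

lemma Dec.act (D : Dec CV B0 B1 B2 B3) (h : SD CV) {w : E} {L : V →ₗ[ℝ] (V →L[ℝ] V)}
    (k : KV CV (B0 w) L) : (∀ a, L (B1 w) (B0 a) = B1 a) ∧ (∀ a, L (B1 w) (B1 a) = B0 a) ∧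
    (∀ a, L (B1 w) (B2 a) = 0) ∧ (∀ a, L (B1 w) (B3 a) = 0) := by
  obtain ⟨M, hM, hs, m0, m1, m2, m3⟩ := D.lyap h
  have := k.uniq M hM hs
  rw [m0] at this
  rw [← this]
  exact ⟨m0, m1, m2, m3⟩

lemma Dec.pa (D : Dec CV B0 B1 B2 B3) (D2 : Dec CV B0 B2 B3 B1) (D3 : Dec CV B0 B3 B1 B2)
    (h : SD CV) {w : E} {L : V →ₗ[ℝ] (V →L[ℝ] V)} (k : KV CV (B0 w) L) :
    Pa CV L w B0 B1 B2 B3 := by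
  obtain ⟨a0, a1, a2, a3⟩ := D.act h k
  obtain ⟨b0, b2, b3, b1⟩ := D2.act h k
  obtain ⟨c0, c3, c1, c2⟩ := D3.act h k
  exact ⟨k, D.inj, D.span, a0, a1, a2, a3, b0, b1, b2, b3, c0, c1, c2, c3,
    fun a b => by simpa using D.inn a 0 0 0 b 0 0 0, fun a b => by simpa using D.inn 0 a 0 0 0 b 0 0,
    fun a b => by simpa using D.inn 0 0 a 0 0 0 b 0, fun a b => by simpa using D.inn 0 0 0 a 0 0 0 b⟩

lemma Dec.of_pauli (β : E →ₗ[ℝ] QubitObservables →ₗ[ℝ] V)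
    (hspan : Submodule.span ℝ {z : V | ∃ a v, β a v = z} = ⊤)
    (hfactor : ∀ (a b : E) (v w : QubitObservables),
      ⟪β a v, β b w⟫ = ⟪a, b⟫ *
        ((v : Matrix (Fin 2) (Fin 2) ℂ) * (w : Matrix (Fin 2) (Fin 2) ℂ)).trace.re)
    (hliftF : ∀ h : QubitObservables ≃ₗ[ℝ] QubitObservables, h '' qubitCone = qubitCone →
      ∃ H : V ≃ₗ[ℝ] V, H '' CV = CV ∧
        ∀ (a : E) (v : QubitObservables), H (β a v) = β a (h v))
    {s1 s2 s3 : QubitObservables} (p1 : Pauli s1 s2 s3) (p2 : Pauli s2 s3 s1) (p3 : Pauli s3 s1 s2) :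
    Dec CV (β.flip 1) (β.flip s1) (β.flip s2) (β.flip s3) := by
  refine ⟨fun z => ?_, ?_, ?_, ?_⟩
  · have hz : z ∈ Submodule.span ℝ {z : V | ∃ a v, β a v = z} := by rw [hspan]; trivial
    induction hz using Submodule.span_induction with
    | mem x hx =>
      obtain ⟨a, v, rfl⟩ := hx
      obtain ⟨r0, r1, r2, r3, rfl⟩ := p1.span v
      exact ⟨r0 • a, r1 • a, r2 • a, r3 • a, by simp only [map_add, map_smul, LinearMap.flip_apply,
        LinearMap.smul_apply]⟩
    | zero => exact ⟨0, 0, 0, 0, by simp⟩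
    | add x y _ _ hx hy =>
      obtain ⟨a, b, c, d, rfl⟩ := hx
      obtain ⟨a', b', c', d', rfl⟩ := hy
      exact ⟨a + a', b + b', c + c', d + d', by simp only [map_add]; abel⟩
    | smul r x _ hx =>
      obtain ⟨a, b, c, d, rfl⟩ := hx
      exact ⟨r • a, r • b, r • c, r • d, by simp only [map_smul, smul_add]⟩
  · intro a b c d a' b' c' d'
    have o : ((1 : QubitObservables) : Matrix (Fin 2) (Fin 2) ℂ) = 1 := rfl
    have e11 := p1.t1
    have e22 := p2.t1
    have e33 := p3.t1
    have e12 := p1.t2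
    have e13 := p1.t3
    have e23 := p2.t2
    have e21 := p2.t3
    have e31 := p3.t2
    have e32 := p3.t3
    have e1 := p1.t0
    have e2 := p2.t0
    have e3 := p3.t0
    have e0 : (1 : Matrix (Fin 2) (Fin 2) ℂ).trace.re = 2 := by simp
    simp only [LinearMap.flip_apply, inner_add_left, inner_add_right, hfactor, o, one_mul, mul_one,
      e0, e1, e2, e3, e11, e12, e13, e21, e22, e23, e31, e32, e33]
    ring
  · obtain ⟨h, hc, h0, h1, h2, h3⟩ := p1.flip
    obtain ⟨H, hH, hl⟩ := hliftF h hc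
    refine ⟨H, hH, fun a => ?_, fun a => ?_, fun a => ?_, fun a => ?_⟩ <;>
    simp only [LinearMap.flip_apply, hl, h0, h1, h2, h3, map_neg]
  · intro t ht
    obtain ⟨h, hc, h0, h1, h2, h3⟩ := p1.boost t ht
    obtain ⟨H, hH, hl⟩ := hliftF h hc
    refine ⟨H, hH, fun a => ?_, fun a => ?_, fun a => ?_, fun a => ?_⟩ <;>
    simp only [LinearMap.flip_apply, hl, h0, h1, h2, h3, map_add, map_smul]

end Setup

end QK

namespace QK

section Final

variable {E V : Type*} [NormedAddCommGroup E] [InnerProductSpace ℝ E] [FiniteDimensional ℝ E]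
  [NormedAddCommGroup V] [InnerProductSpace ℝ V] [FiniteDimensional ℝ V]
  {CE : Set E} {CV : Set V} {B0 : E →ₗ[ℝ] V} {w : E} {L : V →ₗ[ℝ] (V →L[ℝ] V)}
  {P : E →ₗ[ℝ] E →ₗ[ℝ] E}

lemma exp_B0 (hP : ∀ a b, L (B0 a) (B0 b) = B0 (P a b)) (a : E) :
    B0 (NormedSpace.exp (LinearMap.toContinuousLinearMap (P a)) w) =
      NormedSpace.exp (L (B0 a)) (B0 w) := by
  have hpow : ∀ n : ℕ, ((L (B0 a)) ^ n) (B0 w) =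
      B0 (((LinearMap.toContinuousLinearMap (P a)) ^ n) w) := by
    intro n
    induction n with
    | zero => simp
    | succ n ih =>
      rw [pow_succ', pow_succ', mul_apply_eq_comp, mul_apply_eq_comp, ih, hP]
      rfl
  have h1 := hasSum_ev B0 w
    (NormedSpace.exp_series_hasSum_exp' (𝕂 := ℝ) (LinearMap.toContinuousLinearMap (P a)))
  have h2 := hasSum_ev LinearMap.id (B0 w)
    (NormedSpace.exp_series_hasSum_exp' (𝕂 := ℝ) (L (B0 a)))
  refine h1.unique ?_
  simpa [hpow] using h2

lemma mem_of_B0 (hE : SD CE) (hV : SD CV) (hB : ∀ x ∈ CE, B0 x ∈ CV)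
    (hn : ∀ a b, ⟪B0 a, B0 b⟫ = 2 * ⟪a, b⟫) {x : E} (hx : B0 x ∈ CV) : x ∈ CE := by
  refine hE.mem.2 fun y hy => ?_
  have := hV.nonneg (hB y hy) hx
  rw [hn] at this
  linarith

lemma interior_of_B0 (hE : SD CE) (hV : SD CV) (hB : ∀ x ∈ CE, B0 x ∈ CV)
    (hn : ∀ a b, ⟪B0 a, B0 b⟫ = 2 * ⟪a, b⟫) (hx : B0 w ∈ interior CV) : w ∈ interior CE := by
  obtain ⟨δ, hδ, -, h2⟩ := hV.of_interior hx
  refine hE.interior_of (δ := δ / 2) (by positivity) fun y hy => ?_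
  have h3 := h2 _ (hB y hy)
  rw [hn] at h3
  have h4 : ‖y‖ ≤ ‖B0 y‖ := by
    have := hn y y
    rw [real_inner_self_eq_norm_sq, real_inner_self_eq_norm_sq] at this
    refine (sq_le_sq₀ (norm_nonneg _) (norm_nonneg _)).1 ?_
    have := sq_nonneg ‖y‖
    linarith
  have := mul_le_mul_of_nonneg_left h4 hδ.le
  linarith

end Final

end QK

/-- If `(E, C_E, u_E)` is a homogeneous self-dual cone which admits a
locally tomographic composite, with a factorizing self-dualizing inner product, with the
qubit `(E₂, C₂, I)` — the composite being again a homogeneous self-dual cone, admitting the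
liftings of cone automorphisms of either factor — then `(E, C_E, u_E)` is order-isomorphic
to the self-adjoint part of a finite-dimensional complex C*-algebra. -/
theorem selfDual_tensor_qubit_implies_complex_quantum
    {E V : Type*}
    [NormedAddCommGroup E] [InnerProductSpace ℝ E] [FiniteDimensional ℝ E]
    [NormedAddCommGroup V] [InnerProductSpace ℝ V] [FiniteDimensional ℝ V]
    (CE : Set E) (uE : E)
    (hCEsd : CE = {y : E | ∀ x ∈ CE, 0 ≤ ⟪x, y⟫})
    (hCEhom : ∀ x ∈ interior CE, ∀ y ∈ interior CE,
      ∃ g : E ≃ₗ[ℝ] E, g '' CE = CE ∧ g x = y)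
    (huE : uE ∈ interior CE)
    -- the composite system
    (β : E →ₗ[ℝ] QubitObservables →ₗ[ℝ] V)
    (hspan : Submodule.span ℝ {z : V | ∃ a v, β a v = z} = ⊤)
    (hfactor : ∀ (a b : E) (v w : QubitObservables),
      ⟪β a v, β b w⟫ = ⟪a, b⟫ *
        ((v : Matrix (Fin 2) (Fin 2) ℂ) * (w : Matrix (Fin 2) (Fin 2) ℂ)).trace.re)
    (CV : Set V)
    (hCVsd : CV = {y : V | ∀ x ∈ CV, 0 ≤ ⟪x, y⟫})
    (hCVhom : ∀ x ∈ interior CV, ∀ y ∈ interior CV,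
      ∃ g : V ≃ₗ[ℝ] V, g '' CV = CV ∧ g x = y)
    (hβcone : ∀ x ∈ CE, ∀ y ∈ qubitCone, β x y ∈ CV)
    (huV : β uE 1 ∈ interior CV)
    (hliftE : ∀ g : E ≃ₗ[ℝ] E, g '' CE = CE →
      ∃ G : V ≃ₗ[ℝ] V, G '' CV = CV ∧
        ∀ (a : E) (v : QubitObservables), G (β a v) = β (g a) v)
    (hliftF : ∀ h : QubitObservables ≃ₗ[ℝ] QubitObservables, h '' qubitCone = qubitCone →
      ∃ H : V ≃ₗ[ℝ] V, H '' CV = CV ∧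
        ∀ (a : E) (v : QubitObservables), H (β a v) = β a (h v)) :
    ∃ (A : Type) (_ : NormedRing A) (_ : StarRing A) (_ : CStarRing A)
      (_ : NormedAlgebra ℂ A) (_ : FiniteDimensional ℂ A)
      (_ : NormedAlgebra ℝ A) (_ : IsScalarTower ℝ ℂ A)
      (φ : E →ₗ[ℝ] A),
        Function.Injective φ ∧
        Set.range φ = {a : A | IsSelfAdjoint a} ∧
        φ uE = 1 ∧
        φ '' CE = {a : A | IsSelfAdjoint a ∧ ∃ b : A, a = star b * b} := by
  have hE : QK.SD CE := hCEsd
  have hV : QK.SD CV := hCVsd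
  obtain ⟨s1, s2, s3, p1, p2, p3⟩ := QK.exists_pauli
  have D := QK.Dec.of_pauli β hspan hfactor hliftF p1 p2 p3
  have D2 := QK.Dec.of_pauli β hspan hfactor hliftF p2 p3 p1
  have D3 := QK.Dec.of_pauli β hspan hfactor hliftF p3 p1 p2
  have hB : ∀ x ∈ CE, β.flip 1 x ∈ CV := fun x hx =>
    hβcone x hx 1 (by
      change ((1 : QubitObservables) : Matrix (Fin 2) (Fin 2) ℂ).PosSemidef
      simpa using Matrix.PosSemidef.one)
  generalize β.flip 1 = B0 at *
  generalize β.flip s1 = B1 at *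
  generalize β.flip s2 = B2 at *
  generalize β.flip s3 = B3 at *
  obtain ⟨u', hu', hfix⟩ := QK.exists_fixed hV ⟨_, huV⟩
  obtain ⟨w, b, c, d, hdec⟩ := D.span u'
  obtain ⟨hc, hd⟩ := D.fixed hfix hdec
  obtain ⟨-, hb⟩ := D2.fixed hfix (a := w) (b := c) (c := d) (d := b) (by rw [hdec]; abel)
  subst hb hc hd
  simp only [map_zero, add_zero] at hdec
  subst hdec
  obtain ⟨L, k⟩ := QK.exists_KV hV hu' hfix (fun y hy => by
    obtain ⟨g, hg, hgy⟩ := hCVhom _ hu' y hy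
    exact ⟨_, _, QK.IsAut.ofEquiv g hg, hgy⟩)
  have p := D.pa D2 D3 hV k
  have hw : w ∈ interior CE := QK.interior_of_B0 hE hV hB p.n0 hu'
  obtain ⟨P, T, hP, hj⟩ := p.existsJA
  have hexp : ∀ a, NormedSpace.exp (LinearMap.toContinuousLinearMap (P a)) w ∈ CE := fun a => by
    refine QK.mem_of_B0 hE hV hB p.n0 ?_
    rw [QK.exp_B0 hP]
    exact (k.lyap _).exp_mem hV hu' (interior_subset hu')
  obtain ⟨A, iA, hfd, φ, hinj, hr, hφw, hmul⟩ := QK.exists_alg hj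
  have hcone := QK.cone_image hE hj hexp hinj hr hφw hmul
  obtain ⟨g, hg, hgu⟩ := hCEhom uE huE w hw
  refine ⟨A, inferInstance, inferInstance, inferInstance, inferInstance, hfd,
    NormedAlgebra.complexToReal, inferInstance, φ ∘ₗ g.toLinearMap, ?_, ?_, ?_, ?_⟩
  · simpa using hinj.comp g.injective
  · rw [← hr]
    simpa using g.surjective.range_comp φ
  · simp [hgu, hφw]
  · rw [← hcone]
    conv_rhs => rw [← hg, Set.image_image]
    rfl
end
end

section
/- Let E be a finite-dimensional real vector space equipped with a bilinear, commutative product • satisfying the Jordan identity (a•a)•(a•b) = a•((a•a)•b) for all a,b ∈ E, having a unit 1_E (1_E • a = a for all a), and formally real (a•a + b•b = 0 implies a = 0 and b = 0). Let E₂ be the real vector space of self-adjoint 2×2 complex matrices with Jordan product v • w = (vw + wv)/2 and unit the identity matrix I. Suppose the real tensor product E ⊗ℝ E₂ carries a bilinear, commutative product ⋄ satisfying the Jordan identity, formally real, with unit 1_E ⊗ I, and satisfying (a ⊗ I) ⋄ (b ⊗ v) = (a • b) ⊗ v and (1_E ⊗ v) ⋄ (a ⊗ w) = a ⊗ (v •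 w) for all a,b ∈ E and v,w ∈ E₂. Then there exist a finite-dimensional complex C*-algebra A and a real-linear bijection φ : E → selfAdjoint(A) such that φ(1_E) = 1 and φ(a • b) = (φ(a)·φ(b) + φ(b)·φ(a))/2 for all a,b ∈ E; i.e., E is Jordan-isomorphic to the self-adjoint part of a complex C*-algebra. -/
open scoped TensorProduct ComplexOrder

noncomputable section

/-- The Jordan product `v • w = (vw + wv)/2` of self-adjoint `2 × 2` complex matrices. -/
def qubitJordanMul (v w : QubitObservables) : QubitObservables :=
  ⟨(1 / 2 : ℝ) • ((v : Matrix (Fin 2) (Fin 2) ℂ) * (w : Matrix (Fin 2) (Fin 2) ℂ) +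
      (w : Matrix (Fin 2) (Fin 2) ℂ) * (v : Matrix (Fin 2) (Fin 2) ℂ)), by
    have hv : star (v : Matrix (Fin 2) (Fin 2) ℂ) = (v : Matrix (Fin 2) (Fin 2) ℂ) := v.2
    have hw : star (w : Matrix (Fin 2) (Fin 2) ℂ) = (w : Matrix (Fin 2) (Fin 2) ℂ) := w.2
    simp [selfAdjoint.mem_iff, star_smul, star_add, star_mul, hv, hw, add_comm]⟩

set_option linter.unusedSimpArgs false
set_option linter.unusedSectionVars false

theorem ho_lin {J : Type*} [AddCommGroup J] [Module ℝ J] (p : J →ₗ[ℝ] J →ₗ[ℝ] J)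
    (hc : ∀ z w, p z w = p w z) (hj : ∀ z w, p (p z z) (p z w) = p z (p (p z z) w))
    (x y z w : J) :
    p (p x y) (p z w) + p (p y z) (p x w) + p (p z x) (p y w)
      = p x (p (p y z) w) + p y (p (p z x) w) + p z (p (p x y) w) := by
  have h1 := hj (x + y + z) w
  have h2 := hj (x + y) w
  have h3 := hj (y + z) w
  have h4 := hj (x + z) w
  have h5 := hj x w
  have h6 := hj y w
  have h7 := hj z w
  simp only [map_add, LinearMap.add_apply, hc y x, hc z y, hc x z] at h1 h2 h3 h4
  linear_combination (norm := module) (1/2 : ℝ) • (h1 - h2 - h3 - h4 + h5 + h6 + h7)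

theorem ho_step1 {E J : Type*} [AddCommGroup E] [Module ℝ E] [AddCommGroup J] [Module ℝ J]
    (m : E →ₗ[ℝ] E →ₗ[ℝ] E) (hm : ∀ a b, m a b = m b a)
    (u : E) (hu : ∀ a, m u a = a)
    (p : J →ₗ[ℝ] J →ₗ[ℝ] J)
    (hc : ∀ z w, p z w = p w z) (hj : ∀ z w, p (p z z) (p z w) = p z (p (p z z) w))
    (e : E →ₗ[ℝ] J) (s : Fin 3 → E →ₗ[ℝ] J) (q : J →ₗ[ℝ] E) (t : Fin 3 → J →ₗ[ℝ] E)
    (hq : ∀ a, q (e a) = a) (hqs : ∀ i a, q (s i a) = 0)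
    (hte : ∀ i a, t i (e a) = 0) (hts : ∀ i a, t i (s i a) = a)
    (hdec : ∀ z, z = e (q z) + s 0 (t 0 z) + s 1 (t 1 z) + s 2 (t 2 z))
    (hee : ∀ a b, p (e a) (e b) = e (m a b))
    (hes : ∀ i a b, p (e a) (s i b) = s i (m a b))
    (hss : ∀ i a, p (s i u) (s i a) = e a)
    (hssn : ∀ i j a, i ≠ j → p (s i u) (s j a) = 0) :
    ∃ D : E →ₗ[ℝ] E →ₗ[ℝ] E, (∀ a b, D a b = - D b a) ∧
      (∀ a b c, D (m a b) c = m a (D b c) + m b (D a c)) ∧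
      (∀ a b c, m (m a b) c - m a (m b c) = D (D a c) b) := by
  have L := ho_lin p hc hj
  have hone : ∀ z, p (e u) z = z := by
    intro z
    conv_lhs => rw [hdec z]
    simp only [map_add, hee, hes, hu]
    exact (hdec z).symm
  have hmu : ∀ a, m a u = a := fun a => by rw [hm, hu]
  have hse : ∀ i a b, p (s i a) (e b) = s i (m a b) := fun i a b => by rw [hc, hes, hm]
  have sinj : ∀ i a, s i a = 0 → a = 0 := fun i a h => by rw [← hts i a, h, map_zero]
  have einj : ∀ a, e a = 0 → a = 0 := fun a h => by rw [← hq a, h, map_zero]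
  have F1 : ∀ i a w, p (s i a) (p (s i u) w) = p (s i u) (p (s i a) w) := by
    intro i a w
    have h := L (s i u) (s i u) (e a) w
    simp only [hss, hse, hes, hone, hu, hmu] at h
    linear_combination (norm := module) (1/2 : ℝ) • h
  have G : ∀ i a b, p (s i a) (s i b) = e (m a b) := by
    intro i a b
    have h := F1 i a (e b)
    rw [hse, hse, hu, hss] at h
    exact h
  have sz : ∀ i j, i ≠ j → ∀ a b, p (s i u) (p (s i a) (s j b)) = 0 := by
    intro i j hij a b
    rw [← F1, hssn i j b hij, map_zero]
  have sq : ∀ i z, p (s i u) z = 0 → q z = 0 ∧ t i z = 0 := by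
    intro i z h
    rw [hdec z] at h
    have h1 := congrArg q h
    have h2 := congrArg (t i) h
    fin_cases i <;>
    simp [hse, hu, hss, hssn, hq, hqs, hte, hts] at h1 h2 <;> exact ⟨h2, h1⟩
  have K : ∀ i j k, i ≠ j → i ≠ k → j ≠ k → ∀ a b,
      p (s i a) (s j b) = s k (t k (p (s i a) (s j b))) := by
    intro i j k hij hik hjk a b
    have h1 := sq i _ (sz i j hij a b)
    have h2 := sq j _ (sz j i hij.symm b a)
    rw [hc (s j b)] at h2
    have h3 := hdec (p (s i a) (s j b))
    rw [h1.1] at h3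
    refine h3.trans ?_
    replace h1 := h1.2
    replace h2 := h2.2
    clear h3
    generalize p (s i a) (s j b) = z at *
    fin_cases i <;> fin_cases j <;> fin_cases k <;>
      first
      | exact absurd rfl hij
      | exact absurd rfl hik
      | exact absurd rfl hjk
      | (simp at h1 h2; simp [h1, h2])
  have M : ∀ i j k, i ≠ j → i ≠ k → j ≠ k → ∀ a b,
      t i (p (s j a) (s k b)) = - t j (p (s i a) (s k b)) := by
    intro i j k hij hik hjk a b
    have h := L (s i u) (s j u) (e a) (s k b)
    simp only [hssn i k _ hik, hssn j k _ hjk, hssn i j _ hij, hse, hes, hmu, hu, map_zero,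
      LinearMap.zero_apply, add_zero, zero_add] at h
    rw [K j k i hjk hij.symm hik.symm a b, K i k j hik hij hjk.symm a b, hss, hss, ← map_add] at h
    exact eq_neg_of_add_eq_zero_left (einj _ h.symm)
  let D : E →ₗ[ℝ] E →ₗ[ℝ] E := (p.compl₁₂ (s 0) (s 1)).compr₂ (t 2)
  have d01 : ∀ a b, p (s 0 a) (s 1 b) = s 2 (D a b) := fun a b =>
    K 0 1 2 (by decide) (by decide) (by decide) a b
  have d10 : ∀ a b, p (s 1 a) (s 0 b) = s 2 (D b a) := fun a b => by rw [hc, d01]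
  have d21 : ∀ a b, p (s 2 a) (s 1 b) = s 0 (- D a b) := fun a b => by
    rw [K 2 1 0 (by decide) (by decide) (by decide), M 0 2 1 (by decide) (by decide) (by decide),
      d01, hts]
  have d12 : ∀ a b, p (s 1 a) (s 2 b) = s 0 (- D b a) := fun a b => by rw [hc, d21]
  have d02 : ∀ a b, p (s 0 a) (s 2 b) = s 1 (D b a) := fun a b => by
    rw [K 0 2 1 (by decide) (by decide) (by decide), M 1 0 2 (by decide) (by decide) (by decide),
      d12, hts, neg_neg]
  have d20 : ∀ a b, p (s 2 a) (s 0 b) = s 1 (D a b) := fun a b => by rw [hc, d02]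
  have anti : ∀ a b, D a b = - D b a := fun a b => by
    have h := M 2 1 0 (by decide) (by decide) (by decide) b a
    rw [d10, d20, hts, hts] at h
    exact h
  refine ⟨D, anti, ?_, ?_⟩
  · intro a b c
    have h := L (e a) (s 0 b) (s 1 u) (s 2 c)
    have hDu : ∀ b, D b u = 0 := by
      intro b
      apply sinj 2
      rw [← d10, hssn 1 0 _ (by decide)]
    simp only [hes, hse, d01, d10, d21, d12, d02, d20, hu, hmu, hDu, G, map_zero,
      LinearMap.zero_apply, map_neg, hssn 1 2 _ (by decide), hee, hss] at h
    apply sub_eq_zero.1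
    apply einj
    simp only [anti c, map_add, map_sub, map_neg] at h ⊢
    linear_combination (norm := module) (1 : ℝ) • h
  · intro a b c
    have h := L (e a) (s 0 b) (s 1 u) (s 0 c)
    have hDu : ∀ b, D b u = 0 := by
      intro b
      apply sinj 2
      rw [← d10, hssn 1 0 _ (by decide)]
    simp only [hes, hse, d01, d10, d21, d12, d02, d20, hu, hmu, hDu, G, map_zero,
      LinearMap.zero_apply, map_neg, hee, hss] at h
    apply sub_eq_zero.1
    apply sinj 1
    simp only [anti c, map_add, map_sub, map_neg, LinearMap.neg_apply] at h ⊢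
    linear_combination (norm := module) (-1 : ℝ) • h

section
variable {A : Type*} [Ring A] [Algebra ℂ A] [StarRing A] [StarModule ℂ A]

theorem ho_sq (hfr : ∀ a b : A, IsSelfAdjoint a → IsSelfAdjoint b → a * a + b * b = 0 → a = 0 ∧ b = 0)
    (a : A) (ha : IsSelfAdjoint a) (h : a * a = 0) : a = 0 :=
  (hfr a 0 ha (IsSelfAdjoint.zero A) (by simp [h])).1

theorem ho_cart (x : A) : ∃ a b : A, IsSelfAdjoint a ∧ IsSelfAdjoint b ∧ x = a + Complex.I • b := by
  refine ⟨realPart x, imaginaryPart x, (realPart x).2, (imaginaryPart x).2, ?_⟩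
  exact (realPart_add_I_smul_imaginaryPart x).symm

theorem ho_sum (a b : A) (ha : IsSelfAdjoint a) (hb : IsSelfAdjoint b) :
    (a + Complex.I • b) * star (a + Complex.I • b) + star (a + Complex.I • b) * (a + Complex.I • b)
      = (2 : ℂ) • (a * a + b * b) := by
  simp only [star_add, star_smul, ha.star_eq, hb.star_eq, Complex.star_def, Complex.conj_I, mul_add,
    add_mul, smul_mul_assoc, mul_smul_comm, smul_smul, smul_add, neg_smul, mul_neg, neg_mul,
    Complex.I_mul_I, neg_neg, one_smul]
  match_scalars <;> simp <;> norm_num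

theorem ho_proper
    (hfr : ∀ a b : A, IsSelfAdjoint a → IsSelfAdjoint b → a * a + b * b = 0 → a = 0 ∧ b = 0)
    (x : A) (h : x * star x = 0) : x = 0 := by
  have h2 : star x * x = 0 := by
    apply ho_sq hfr _ (IsSelfAdjoint.star_mul_self x)
    rw [mul_assoc, ← mul_assoc x, h, zero_mul, mul_zero]
  obtain ⟨a, b, ha, hb, rfl⟩ := ho_cart x
  have h3 := ho_sum a b ha hb
  rw [h, h2, add_zero] at h3
  have h4 := (smul_eq_zero.1 h3.symm).resolve_left two_ne_zero
  obtain ⟨rfl, rfl⟩ := hfr a b ha hb h4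
  simp

theorem ho_real
    (hfr : ∀ a b : A, IsSelfAdjoint a → IsSelfAdjoint b → a * a + b * b = 0 → a = 0 ∧ b = 0)
    (h : A) (hh : IsSelfAdjoint h) (w : A) (hw : w ≠ 0) (l : ℂ) (hl : h * w = l • w) :
    (starRingEnd ℂ) l = l := by
  set v := w * star w with hv
  have hv0 : v ≠ 0 := fun h => hw (ho_proper hfr w h)
  have hvs : IsSelfAdjoint v := IsSelfAdjoint.mul_star_self w
  have h1 : h * v = l • v := by rw [hv, ← mul_assoc, hl, smul_mul_assoc]
  have h2 : v * h = (starRingEnd ℂ l) • v := by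
    have := congrArg star h1
    rw [star_mul, star_smul, hvs.star_eq, hh.star_eq] at this
    exact this
  have h3 : (starRingEnd ℂ l - l) • (v * v) = 0 := by
    rw [sub_smul, ← smul_mul_assoc, ← h2, ← mul_smul_comm l, ← h1, mul_assoc, sub_self]
  rcases smul_eq_zero.1 h3 with h | h
  · exact sub_eq_zero.1 h
  · exact absurd (ho_sq hfr v hvs h) hv0

variable [FiniteDimensional ℂ A]

/-- trace of left multiplication -/
def hoTr (A : Type*) [Ring A] [Algebra ℂ A] : A →ₗ[ℂ] ℂ :=
  (LinearMap.trace ℂ A) ∘ₗ (Algebra.lmul ℂ A).toLinearMap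

theorem hoTr_comm (x y : A) : hoTr A (x * y) = hoTr A (y * x) := by
  simp only [hoTr, LinearMap.comp_apply, AlgHom.toLinearMap_apply, map_mul]
  exact LinearMap.trace_mul_comm ℂ _ _

theorem hoTr_eq (x : A) : hoTr A x = (LinearMap.charpoly (Algebra.lmul ℂ A x)).roots.sum :=
  Module.End.trace_eq_sum_roots_charpoly_of_splits (IsAlgClosed.splits _)

theorem ho_eig (x : A) (l : ℂ) (hl : l ∈ (LinearMap.charpoly (Algebra.lmul ℂ A x)).roots) :
    l ∈ spectrum ℂ (Algebra.lmul ℂ A x) :=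
  (Module.End.mem_spectrum_iff_isRoot_charpoly _ _).2 (Polynomial.isRoot_of_mem_roots hl)

theorem ho_spec
    (hfr : ∀ a b : A, IsSelfAdjoint a → IsSelfAdjoint b → a * a + b * b = 0 → a = 0 ∧ b = 0)
    (h : A) (hh : IsSelfAdjoint h) (l : ℂ) (hl : l ∈ spectrum ℂ (Algebra.lmul ℂ A h)) :
    (starRingEnd ℂ) l = l := by
  obtain ⟨w, hw⟩ := (Module.End.hasEigenvalue_iff_mem_spectrum.2 hl).exists_hasEigenvector
  exact ho_real hfr h hh w hw.2 l hw.apply_eq_smul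

theorem hoTr_real
    (hfr : ∀ a b : A, IsSelfAdjoint a → IsSelfAdjoint b → a * a + b * b = 0 → a = 0 ∧ b = 0)
    (h : A) (hh : IsSelfAdjoint h) : (starRingEnd ℂ) (hoTr A h) = hoTr A h := by
  rw [hoTr_eq, map_multiset_sum]
  congr 1
  conv_rhs => rw [← Multiset.map_id (LinearMap.charpoly (Algebra.lmul ℂ A h)).roots]
  exact Multiset.map_congr rfl fun l hl => ho_spec hfr h hh l (ho_eig h l hl)

theorem hoTr_star
    (hfr : ∀ a b : A, IsSelfAdjoint a → IsSelfAdjoint b → a * a + b * b = 0 → a = 0 ∧ b = 0)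
    (x : A) : hoTr A (star x) = (starRingEnd ℂ) (hoTr A x) := by
  obtain ⟨a, b, ha, hb, rfl⟩ := ho_cart x
  simp [ha.star_eq, hb.star_eq, hoTr_real hfr a ha, hoTr_real hfr b hb]

open scoped ComplexOrder in
theorem hoTr_sq
    (hfr : ∀ a b : A, IsSelfAdjoint a → IsSelfAdjoint b → a * a + b * b = 0 → a = 0 ∧ b = 0)
    (h : A) (hh : IsSelfAdjoint h) :
    0 ≤ hoTr A (h * h) ∧ (hoTr A (h * h) = 0 → h = 0) := by
  have key : ∀ l ∈ (LinearMap.charpoly (Algebra.lmul ℂ A (h * h))).roots, 0 ≤ l := by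
    intro l hl
    have h1 := ho_eig _ l hl
    rw [← pow_two, map_pow, spectrum.map_pow_of_pos _ two_pos] at h1
    obtain ⟨k, hk, rfl⟩ := h1
    have h2 := ho_spec hfr h hh k hk
    obtain ⟨r, rfl⟩ := Complex.conj_eq_iff_real.1 h2
    simp only
    exact_mod_cast sq_nonneg r
  rw [hoTr_eq]
  refine ⟨Multiset.sum_nonneg key, fun h0 => ?_⟩
  have h1 : ∀ l ∈ (LinearMap.charpoly (Algebra.lmul ℂ A (h * h))).roots, l = 0 := by
    exact Multiset.all_zero_of_le_zero_le_of_sum_eq_zero key h0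
  have h2 : LinearMap.charpoly (Algebra.lmul ℂ A (h * h))
      = Polynomial.X ^ (Module.finrank ℂ A) := by
    have hs := IsAlgClosed.splits (LinearMap.charpoly (Algebra.lmul ℂ A (h * h)))
    have h3 := hs.eq_prod_roots_of_monic (LinearMap.charpoly_monic _)
    have h4 := hs.natDegree_eq_card_roots
    rw [Multiset.eq_replicate_card.2 h1] at h3
    rw [LinearMap.charpoly_natDegree] at h4
    rw [h3, h4]
    simp
  obtain ⟨n, hn⟩ := (LinearMap.isNilpotent_iff_charpoly _).2 h2
  rw [← map_pow] at hn
  have hn' : (h * h) ^ n = 0 := by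
    have := congrArg (fun f => f 1) hn
    simpa using this
  have hp : ∀ k : ℕ, h ^ (2 ^ k) = 0 → h = 0 := by
    intro k
    induction k with
    | zero => simp
    | succ k ih =>
      intro hk
      apply ih
      apply ho_sq hfr _ (hh.pow _)
      rw [← pow_add, ← two_mul, ← pow_succ']
      exact hk
  apply hp (2 * n)
  rw [← pow_two, ← pow_mul] at hn'
  exact pow_eq_zero_of_le Nat.lt_two_pow_self.le hn'

open scoped ComplexOrder in
theorem hoTr_pos
    (hfr : ∀ a b : A, IsSelfAdjoint a → IsSelfAdjoint b → a * a + b * b = 0 → a = 0 ∧ b = 0)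
    (x : A) : 0 ≤ hoTr A (star x * x) ∧ (hoTr A (star x * x) = 0 → x = 0) := by
  obtain ⟨a, b, ha, hb, rfl⟩ := ho_cart x
  have h3 := congrArg (hoTr A) (ho_sum a b ha hb)
  rw [map_add, hoTr_comm, ← two_mul, map_smul, smul_eq_mul, map_add] at h3
  have h4 := mul_left_cancel₀ two_ne_zero h3
  rw [h4]
  have h5 := hoTr_sq hfr a ha
  have h6 := hoTr_sq hfr b hb
  refine ⟨add_nonneg h5.1 h6.1, fun h => ?_⟩
  have h7 := (add_eq_zero_iff_of_nonneg h5.1 h6.1).1 h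
  rw [h5.2 h7.1, h6.2 h7.2]
  simp

theorem ho_rep
    (hfr : ∀ a b : A, IsSelfAdjoint a → IsSelfAdjoint b → a * a + b * b = 0 → a = 0 ∧ b = 0) :
    ∃ (n : ℕ) (ρ : A →⋆ₐ[ℂ] Matrix (Fin n) (Fin n) ℂ), Function.Injective ρ := by
  let core : InnerProductSpace.Core ℂ A :=
    { inner := fun x y => hoTr A (star x * y)
      conj_inner_symm := fun x y => by
        rw [← hoTr_star hfr, star_mul, star_star]
      re_inner_nonneg := fun x => (Complex.le_def.1 (hoTr_pos hfr x).1).1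
      add_left := fun x y z => by simp [add_mul]
      smul_left := fun x y r => by simp
      definite := fun x h => (hoTr_pos hfr x).2 h }
  let _ : NormedAddCommGroup A := core.toNormedAddCommGroup
  let _ : InnerProductSpace ℂ A := InnerProductSpace.ofCore core.toCore
  have hin : ∀ x y : A, inner ℂ x y = hoTr A (star x * y) := fun _ _ => rfl
  let v := stdOrthonormalBasis ℂ A
  let Φ := LinearMap.toMatrixOrthonormal v
  have hadj : ∀ x : A, star (Algebra.lmul ℂ A x : A →ₗ[ℂ] A) = Algebra.lmul ℂ A (star x) := by
    intro x
    rw [LinearMap.star_eq_adjoint]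
    symm
    rw [LinearMap.eq_adjoint_iff]
    intro a b
    rw [hin, hin]
    simp [mul_assoc]
  refine ⟨Module.finrank ℂ A, ⟨Φ.toAlgEquiv.toAlgHom.comp (Algebra.lmul ℂ A), ?_⟩, ?_⟩
  · intro x
    change Φ (Algebra.lmul ℂ A (star x)) = star (Φ (Algebra.lmul ℂ A x))
    rw [← hadj, map_star]
  · intro x y hxy
    have h1 : Φ (Algebra.lmul ℂ A x) = Φ (Algebra.lmul ℂ A y) := hxy
    have h2 := congrArg (fun f => f 1) (Φ.injective h1)
    simpa using h2

open scoped Matrix.Norms.L2Operator in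
theorem ho_cstar
    (hfr : ∀ a b : A, IsSelfAdjoint a → IsSelfAdjoint b → a * a + b * b = 0 → a = 0 ∧ b = 0)
    {E : Type*} [AddCommGroup E] [Module ℝ E] (m : E →ₗ[ℝ] E →ₗ[ℝ] E) (u : E) 
    (f : E →+ A) (hfs : ∀ (r : ℝ) a, f (r • a) = (r : ℂ) • f a) 
    (hinj : Function.Injective f) (hrange : ∀ x, IsSelfAdjoint x ↔ ∃ a, f a = x)
    (hu : f u = 1) (hm : ∀ a b, f (m a b) = (1/2 : ℂ) • (f a * f b + f b * f a)) :
    ∃ (A : Type) (_ : NormedRing A) (_ : StarRing A) (_ : CStarRing A)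
      (_ : NormedAlgebra ℂ A) (_ : FiniteDimensional ℂ A)
      (_ : NormedAlgebra ℝ A) (_ : IsScalarTower ℝ ℂ A)
      (φ : E →ₗ[ℝ] A),
        Function.Injective φ ∧
        Set.range φ = {a : A | IsSelfAdjoint a} ∧
        φ u = 1 ∧
        ∀ a b : E, φ (m a b) = (1 / 2 : ℝ) • (φ a * φ b + φ b * φ a) := by
  obtain ⟨n, ρ, hρ⟩ := ho_rep hfr
  let i2 : NormedAlgebra ℝ ρ.range := NormedAlgebra.restrictScalars ℝ ℂ ρ.range
  have hsm : ∀ (r : ℝ) (x : ρ.range), r • x = (r : ℂ) • x := fun _ _ => rfl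
  refine ⟨ρ.range, inferInstance, inferInstance, inferInstance, inferInstance,
    FiniteDimensional.finiteDimensional_submodule ρ.range.toSubalgebra.toSubmodule,
    i2, ⟨fun r c x => ?_⟩,
    { toFun := fun a => ⟨ρ (f a), ⟨f a, rfl⟩⟩
      map_add' := fun a b => by ext1; simp
      map_smul' := fun r a => by
        rw [hsm]; apply Subtype.ext
        change ρ (f (r • a)) = (r : ℂ) • ρ (f a)
        rw [hfs, map_smul] }, ?_, ?_, ?_, ?_⟩
  · rw [hsm, smul_smul]; rfl
  · intro a b h
    exact hinj (hρ (congrArg Subtype.val h))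
  · ext ⟨y, ⟨x, hx⟩⟩
    have hx : ρ x = y := hx
    subst hx
    have h1 : IsSelfAdjoint (⟨ρ x, ⟨x, rfl⟩⟩ : ρ.range) ↔ IsSelfAdjoint x := by
      constructor
      · intro h
        have h2 : star (ρ x) = ρ x := congrArg Subtype.val h
        rw [← map_star] at h2
        exact hρ h2
      · intro h
        apply Subtype.ext
        change star (ρ x) = ρ x
        rw [← map_star, h.star_eq]
    change _ ↔ IsSelfAdjoint (⟨ρ x, ⟨x, rfl⟩⟩ : ρ.range)
    rw [h1, hrange]
    constructor
    · rintro ⟨a, ha⟩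
      exact ⟨a, hρ (congrArg Subtype.val ha)⟩
    · rintro ⟨a, rfl⟩
      exact ⟨a, rfl⟩
  · apply Subtype.ext
    change ρ (f u) = 1
    rw [hu, map_one]
  · intro a b
    rw [hsm]
    apply Subtype.ext
    change ρ (f (m a b)) = _
    rw [hm]
    simp
end

/-- Jordan product and Lie-type product on `E` which together give an associative product
on the complexification. -/
structure HOData (E : Type*) [AddCommGroup E] [Module ℝ E] where
  m : E →ₗ[ℝ] E →ₗ[ℝ] E
  D : E →ₗ[ℝ] E →ₗ[ℝ] E
  u : E
  comm : ∀ a b, m a b = m b a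
  anti : ∀ a b, D a b = - D b a
  leib : ∀ a b c, D (m a b) c = m a (D b c) + m b (D a c)
  assoc : ∀ a b c, m (m a b) c - m a (m b c) = D (D a c) b
  unit : ∀ a, m u a = a

namespace HOData
variable {E : Type*} [AddCommGroup E] [Module ℝ E] (d : HOData E)

/-- The complexification of `E`. -/
def Alg (_ : HOData E) := E × E

instance : AddCommGroup d.Alg := inferInstanceAs (AddCommGroup (E × E))

theorem ext' {x y : d.Alg} (h1 : x.1 = y.1) (h2 : x.2 = y.2) : x = y := Prod.ext h1 h2

instance : Mul d.Alg := ⟨fun x y =>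
  (d.m x.1 y.1 - d.m x.2 y.2 + d.D x.1 y.2 + d.D x.2 y.1,
   d.m x.1 y.2 + d.m x.2 y.1 - d.D x.1 y.1 + d.D x.2 y.2)⟩
instance : One d.Alg := ⟨(d.u, 0)⟩
instance : Star d.Alg := ⟨fun x => (x.1, - x.2)⟩
instance : SMul ℂ d.Alg := ⟨fun z x => (z.re • x.1 - z.im • x.2, z.re • x.2 + z.im • x.1)⟩

theorem mul_1 (x y : d.Alg) : (x * y).1 = d.m x.1 y.1 - d.m x.2 y.2 + d.D x.1 y.2 + d.D x.2 y.1 := rfl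
theorem mul_2 (x y : d.Alg) : (x * y).2 = d.m x.1 y.2 + d.m x.2 y.1 - d.D x.1 y.1 + d.D x.2 y.2 := rfl
theorem one_1 : (1 : d.Alg).1 = d.u := rfl
theorem one_2 : (1 : d.Alg).2 = 0 := rfl
theorem star_1 (x : d.Alg) : (star x).1 = x.1 := rfl
theorem star_2 (x : d.Alg) : (star x).2 = - x.2 := rfl
theorem smul_1 (z : ℂ) (x : d.Alg) : (z • x).1 = z.re • x.1 - z.im • x.2 := rfl
theorem smul_2 (z : ℂ) (x : d.Alg) : (z • x).2 = z.re • x.2 + z.im • x.1 := rfl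
theorem add_1 (x y : d.Alg) : (x + y).1 = x.1 + y.1 := rfl
theorem add_2 (x y : d.Alg) : (x + y).2 = x.2 + y.2 := rfl
theorem zero_1 : (0 : d.Alg).1 = 0 := rfl
theorem zero_2 : (0 : d.Alg).2 = 0 := rfl

theorem unit' (a : E) : d.m a d.u = a := by rw [d.comm, d.unit]

theorem Du (c : E) : d.D d.u c = 0 := by
  have h := d.leib d.u d.u c
  rw [d.unit, d.unit] at h
  exact left_eq_add.1 h

theorem Du' (c : E) : d.D c d.u = 0 := by rw [d.anti, d.Du, neg_zero]

theorem asR (a b c : E) :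
    d.m (d.m a b) c - d.D (d.D a b) c = d.m a (d.m b c) - d.D a (d.D b c) := by
  have h1 := d.assoc a b c
  have h2 := d.assoc b c a
  have h3 := d.assoc c a b
  have h4 := d.anti a (d.D b c)
  rw [d.anti c b, map_neg, LinearMap.neg_apply] at h3
  rw [d.anti b a, map_neg, LinearMap.neg_apply] at h2
  rw [d.comm (d.m b c) a, d.comm c a] at h2
  rw [d.comm (d.m c a) b, d.comm c (d.m a b), d.comm c a] at h3
  linear_combination (norm := module) (1 : ℝ) • h4 - (1 : ℝ) • h2 - (1 : ℝ) • h3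

theorem asI (a b c : E) :
    d.m (d.D a b) c + d.D (d.m a b) c = d.m a (d.D b c) + d.D a (d.m b c) := by
  have h1 := d.leib a b c
  have h2 := d.leib b c a
  rw [d.anti _ a, d.anti c a, d.anti b a, map_neg, map_neg] at h2
  rw [d.comm _ c]
  linear_combination (norm := module) (1 : ℝ) • h1 + (1 : ℝ) • h2

instance : Ring d.Alg :=
  { (inferInstance : AddCommGroup d.Alg), (inferInstance : Mul d.Alg),
    (inferInstance : One d.Alg) with
    left_distrib := fun x y z => by
      apply d.ext' <;> simp only [mul_1, mul_2, add_1, add_2, map_add] <;> module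
    right_distrib := fun x y z => by
      apply d.ext' <;> simp only [mul_1, mul_2, add_1, add_2, map_add, LinearMap.add_apply] <;>
        module
    zero_mul := fun x => by
      apply d.ext' <;> simp [mul_1, mul_2, zero_1, zero_2]
    mul_zero := fun x => by
      apply d.ext' <;> simp [mul_1, mul_2, zero_1, zero_2]
    one_mul := fun x => by
      apply d.ext' <;> simp [mul_1, mul_2, one_1, one_2, d.unit, d.Du]
    mul_one := fun x => by
      apply d.ext' <;> simp [mul_1, mul_2, one_1, one_2, d.unit', d.Du']
    mul_assoc := fun x y z => by
      apply d.ext'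
      · simp only [mul_1, mul_2, map_add, map_sub, LinearMap.add_apply, LinearMap.sub_apply]
        linear_combination (norm := module) (1 : ℝ) • d.asR x.1 y.1 z.1
          - (1 : ℝ) • d.asR x.1 y.2 z.2 - (1 : ℝ) • d.asR x.2 y.1 z.2
          - (1 : ℝ) • d.asR x.2 y.2 z.1 + (1 : ℝ) • d.asI x.1 y.1 z.2
          + (1 : ℝ) • d.asI x.1 y.2 z.1 + (1 : ℝ) • d.asI x.2 y.1 z.1
          - (1 : ℝ) • d.asI x.2 y.2 z.2
      · simp only [mul_1, mul_2, map_add, map_sub, LinearMap.add_apply, LinearMap.sub_apply]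
        linear_combination (norm := module) (-1 : ℝ) • d.asI x.1 y.1 z.1
          + (1 : ℝ) • d.asI x.1 y.2 z.2 + (1 : ℝ) • d.asI x.2 y.1 z.2
          + (1 : ℝ) • d.asI x.2 y.2 z.1 + (1 : ℝ) • d.asR x.1 y.1 z.2
          + (1 : ℝ) • d.asR x.1 y.2 z.1 + (1 : ℝ) • d.asR x.2 y.1 z.1
          - (1 : ℝ) • d.asR x.2 y.2 z.2 }

instance : StarRing d.Alg :=
  { (inferInstance : Star d.Alg) with
    star_involutive := fun x => by
      apply d.ext' <;> simp [star_1, star_2]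
    star_add := fun x y => by
      apply d.ext' <;> simp [star_1, star_2, add_1, add_2, add_comm]
    star_mul := fun x y => by
      apply d.ext' <;> simp only [star_1, star_2, mul_1, mul_2, map_neg, LinearMap.neg_apply,
        d.comm y.1, d.comm y.2, d.anti y.1, d.anti y.2] <;> module }

instance : Module ℂ d.Alg :=
  { (inferInstance : SMul ℂ d.Alg) with
    one_smul := fun x => by apply d.ext' <;> simp [smul_1, smul_2]
    mul_smul := fun z w x => by
      apply d.ext' <;> simp only [smul_1, smul_2, Complex.mul_re, Complex.mul_im] <;> module
    smul_zero := fun x => by apply d.ext' <;> simp [smul_1, smul_2, zero_1, zero_2]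
    zero_smul := fun x => by apply d.ext' <;> simp [smul_1, smul_2, zero_1, zero_2]
    smul_add := fun z x y => by
      apply d.ext' <;> simp only [smul_1, smul_2, add_1, add_2] <;> module
    add_smul := fun z w x => by
      apply d.ext' <;> simp only [smul_1, smul_2, add_1, add_2, Complex.add_re, Complex.add_im] <;>
        module }

instance : Algebra ℂ d.Alg := Algebra.ofModule
  (fun z x y => by
    apply d.ext' <;> simp only [smul_1, smul_2, mul_1, mul_2, map_add, map_sub, map_smul,
      LinearMap.add_apply, LinearMap.sub_apply, LinearMap.smul_apply] <;> module)
  (fun z x y => by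
    apply d.ext' <;> simp only [smul_1, smul_2, mul_1, mul_2, map_add, map_sub, map_smul,
      LinearMap.add_apply, LinearMap.sub_apply, LinearMap.smul_apply] <;> module)

instance : StarModule ℂ d.Alg := ⟨fun z x => by
  apply d.ext' <;> simp only [smul_1, smul_2, star_1, star_2, Complex.star_def, Complex.conj_re,
    Complex.conj_im] <;> module⟩

/-- The identity map, as a real linear map. -/
def ofPair : E × E →ₗ[ℝ] d.Alg where
  toFun x := x
  map_add' _ _ := rfl
  map_smul' r x := by
    change _ = (r : ℂ) • (show d.Alg from x)
    apply d.ext'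
    · rw [smul_1]; simp
    · rw [smul_2]; simp

instance [FiniteDimensional ℝ E] : FiniteDimensional ℂ d.Alg :=
  have : FiniteDimensional ℝ d.Alg := Module.Finite.of_surjective d.ofPair (fun x => ⟨x, rfl⟩)
  Module.Finite.of_restrictScalars_finite ℝ ℂ d.Alg

/-- The inclusion of `E`. -/
def inc : E →+ d.Alg where
  toFun a := (a, 0)
  map_zero' := rfl
  map_add' a b := d.ext' rfl (add_zero (0 : E)).symm

theorem inc_1 (a : E) : (d.inc a).1 = a := rfl
theorem inc_2 (a : E) : (d.inc a).2 = 0 := rfl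

theorem sa_iff (x : d.Alg) : IsSelfAdjoint x ↔ ∃ a, d.inc a = x := by
  constructor
  · intro h
    refine ⟨x.1, d.ext' rfl ?_⟩
    have h1 : - x.2 = x.2 := congrArg Prod.snd h
    have h2 : (2 : ℝ) • x.2 = 0 := by
      rw [two_smul]
      nth_rewrite 1 [← h1]
      simp
    exact ((smul_eq_zero.1 h2).resolve_left two_ne_zero).symm
  · rintro ⟨a, rfl⟩
    apply d.ext' <;> simp [star_1, star_2, inc_2]

theorem inc_mul (a b : E) : d.inc (d.m a b) = (1/2 : ℂ) • (d.inc a * d.inc b + d.inc b * d.inc a) := by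
  apply d.ext' <;> simp only [smul_1, smul_2, add_1, add_2, mul_1, mul_2, inc_1, inc_2, d.comm b a,
    d.anti b a, map_zero, LinearMap.zero_apply] <;> norm_num <;> module

end HOData

theorem ho_step2 {E : Type*} [AddCommGroup E] [Module ℝ E] [FiniteDimensional ℝ E]
    (d : HOData E) (hfr : ∀ a b : E, d.m a a + d.m b b = 0 → a = 0 ∧ b = 0) :
    ∃ (A : Type) (_ : NormedRing A) (_ : StarRing A) (_ : CStarRing A)
      (_ : NormedAlgebra ℂ A) (_ : FiniteDimensional ℂ A)
      (_ : NormedAlgebra ℝ A) (_ : IsScalarTower ℝ ℂ A)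
      (φ : E →ₗ[ℝ] A),
        Function.Injective φ ∧
        Set.range φ = {a : A | IsSelfAdjoint a} ∧
        φ d.u = 1 ∧
        ∀ a b : E, φ (d.m a b) = (1 / 2 : ℝ) • (φ a * φ b + φ b * φ a) := by
  refine ho_cstar (A := d.Alg) ?_ d.m d.u d.inc ?_ ?_ d.sa_iff rfl d.inc_mul
  · intro a b ha hb h
    obtain ⟨a, rfl⟩ := (d.sa_iff a).1 ha
    obtain ⟨b, rfl⟩ := (d.sa_iff b).1 hb
    have h1 := congrArg Prod.fst h
    change (d.inc a * d.inc a + d.inc b * d.inc b).1 = (0 : d.Alg).1 at h1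
    simp only [HOData.add_1, HOData.mul_1, HOData.inc_1, HOData.inc_2, HOData.zero_1, map_zero,
      LinearMap.zero_apply, add_zero, sub_zero] at h1
    obtain ⟨rfl, rfl⟩ := hfr a b h1
    exact ⟨map_zero _, map_zero _⟩
  · intro r a
    apply d.ext'
    · rw [HOData.smul_1, HOData.inc_1, HOData.inc_1, HOData.inc_2]; simp
    · rw [HOData.smul_2, HOData.inc_1, HOData.inc_2, HOData.inc_2]; simp
  · intro a b h
    exact congrArg Prod.fst h

section Pauli

/-- Pauli coordinates. -/
def hoPauli : Fin 3 → QubitObservables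
  | 0 => ⟨!![0, 1; 1, 0], by
      rw [selfAdjoint.mem_iff]; ext i j; fin_cases i <;> fin_cases j <;> simp⟩
  | 1 => ⟨!![0, -Complex.I; Complex.I, 0], by
      rw [selfAdjoint.mem_iff]; ext i j; fin_cases i <;> fin_cases j <;> simp⟩
  | 2 => ⟨!![1, 0; 0, -1], by
      rw [selfAdjoint.mem_iff]; ext i j; fin_cases i <;> fin_cases j <;> simp⟩

/-- Identity coordinate. -/
def hoC0 : QubitObservables →ₗ[ℝ] ℝ where
  toFun v := ((v.1 0 0).re + (v.1 1 1).re) / 2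
  map_add' v w := by simp; ring
  map_smul' r v := by simp; ring

/-- Pauli coordinates. -/
def hoC : Fin 3 → QubitObservables →ₗ[ℝ] ℝ
  | 0 =>
    { toFun := fun v => (v.1 0 1).re
      map_add' := fun v w => by simp
      map_smul' := fun r v => by simp }
  | 1 =>
    { toFun := fun v => - (v.1 0 1).im
      map_add' := fun v w => by simp; ring
      map_smul' := fun r v => by simp }
  | 2 =>
    { toFun := fun v => ((v.1 0 0).re - (v.1 1 1).re) / 2
      map_add' := fun v w => by simp; ring
      map_smul' := fun r v => by simp; ring }

theorem hoC_0 (v : QubitObservables) : hoC 0 v = (v.1 0 1).re := rfl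
theorem hoC_1 (v : QubitObservables) : hoC 1 v = - (v.1 0 1).im := rfl
theorem hoC_2 (v : QubitObservables) : hoC 2 v = ((v.1 0 0).re - (v.1 1 1).re) / 2 := rfl

theorem hoC_dec (v : QubitObservables) : v = hoC0 v • (1 : QubitObservables)
    + hoC 0 v • hoPauli 0 + hoC 1 v • hoPauli 1 + hoC 2 v • hoPauli 2 := by
  have h := selfAdjoint.mem_iff.1 v.2
  have h00 := congrFun (congrFun h 0) 0
  have h01 := congrFun (congrFun h 0) 1
  have h11 := congrFun (congrFun h 1) 1
  rw [Matrix.star_apply, Complex.ext_iff] at h00 h01 h11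
  simp at h00 h01 h11
  apply Subtype.ext
  ext i j
  fin_cases i <;> fin_cases j <;> apply Complex.ext <;>
    simp [hoC0, hoC_0, hoC_1, hoC_2, hoPauli] <;> linarith

theorem hoC0_one : hoC0 1 = 1 := by simp [hoC0]
theorem hoC0_pauli (i) : hoC0 (hoPauli i) = 0 := by fin_cases i <;> simp [hoC0, hoPauli]
theorem hoC_one (i) : hoC i 1 = 0 := by fin_cases i <;> simp [hoC_0, hoC_1, hoC_2]
theorem hoC_pauli (i) : hoC i (hoPauli i) = 1 := by fin_cases i <;> simp [hoC_0, hoC_1, hoC_2, hoPauli]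

theorem hoPauli_sq (i) : qubitJordanMul (hoPauli i) (hoPauli i) = 1 := by
  apply Subtype.ext
  ext a b
  fin_cases i <;> fin_cases a <;> fin_cases b <;> apply Complex.ext <;>
    simp [qubitJordanMul, hoPauli] <;> norm_num

theorem hoPauli_mul (i j) (h : i ≠ j) : qubitJordanMul (hoPauli i) (hoPauli j) = 0 := by
  apply Subtype.ext
  ext a b
  fin_cases i <;> fin_cases j <;> first | exact absurd rfl h | skip
  all_goals fin_cases a <;> fin_cases b <;> simp [qubitJordanMul, hoPauli]

end Pauli

/-- **Hanche-Olsen, finite-dimensional case.** If a formally real Jordan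
algebra `E` is such that `E ⊗ E₂` (`E₂` the qubit Jordan algebra) carries a formally real
Jordan product restricting to the products of `E` and `E₂` on the two factors, then `E` is
Jordan-isomorphic to the self-adjoint part of a finite-dimensional complex C*-algebra. -/
theorem hanche_olsen_tensor_qubit
    {E : Type*} [AddCommGroup E] [Module ℝ E] [FiniteDimensional ℝ E]
    (m : E →ₗ[ℝ] E →ₗ[ℝ] E)
    (hcomm : ∀ a b : E, m a b = m b a)
    (hjordan : ∀ a b : E, m (m a a) (m a b) = m a (m (m a a) b))
    (oneE : E) (hone : ∀ a : E, m oneE a = a)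
    (hfr : ∀ a b : E, m a a + m b b = 0 → a = 0 ∧ b = 0)
    (mT : (E ⊗[ℝ] QubitObservables) →ₗ[ℝ] (E ⊗[ℝ] QubitObservables) →ₗ[ℝ]
      (E ⊗[ℝ] QubitObservables))
    (hTcomm : ∀ z w : E ⊗[ℝ] QubitObservables, mT z w = mT w z)
    (hTjordan : ∀ z w : E ⊗[ℝ] QubitObservables,
      mT (mT z z) (mT z w) = mT z (mT (mT z z) w))
    (hTone : ∀ z : E ⊗[ℝ] QubitObservables, mT (oneE ⊗ₜ[ℝ] (1 : QubitObservables)) z = z)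
    (hTfr : ∀ z w : E ⊗[ℝ] QubitObservables, mT z z + mT w w = 0 → z = 0 ∧ w = 0)
    (hleft : ∀ (a b : E) (v : QubitObservables),
      mT (a ⊗ₜ[ℝ] (1 : QubitObservables)) (b ⊗ₜ[ℝ] v) = (m a b) ⊗ₜ[ℝ] v)
    (hright : ∀ (a : E) (v w : QubitObservables),
      mT (oneE ⊗ₜ[ℝ] v) (a ⊗ₜ[ℝ] w) = a ⊗ₜ[ℝ] (qubitJordanMul v w)) :
    ∃ (A : Type) (_ : NormedRing A) (_ : StarRing A) (_ : CStarRing A)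
      (_ : NormedAlgebra ℂ A) (_ : FiniteDimensional ℂ A)
      (_ : NormedAlgebra ℝ A) (_ : IsScalarTower ℝ ℂ A)
      (φ : E →ₗ[ℝ] A),
        Function.Injective φ ∧
        Set.range φ = {a : A | IsSelfAdjoint a} ∧
        φ oneE = 1 ∧
        ∀ a b : E, φ (m a b) = (1 / 2 : ℝ) • (φ a * φ b + φ b * φ a) := by
  obtain ⟨D, h1, h2, h3⟩ := ho_step1 m hcomm oneE hone mT hTcomm hTjordan
    ((TensorProduct.mk ℝ E QubitObservables).flip 1)
    (fun i => (TensorProduct.mk ℝ E QubitObservables).flip (hoPauli i))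
    ((TensorProduct.rid ℝ E).toLinearMap ∘ₗ hoC0.lTensor E)
    (fun i => (TensorProduct.rid ℝ E).toLinearMap ∘ₗ (hoC i).lTensor E)
    (by intro a; simp [hoC0_one]) (by intro i a; simp [hoC0_pauli])
    (by intro i a; simp [hoC_one]) (by intro i a; simp [hoC_pauli])
    (by
      intro z
      induction z using TensorProduct.induction_on with
      | zero => simp
      | tmul a v =>
        conv_lhs => rw [hoC_dec v]
        simp [TensorProduct.tmul_add, TensorProduct.smul_tmul]
      | add x y hx hy =>
        conv_lhs => rw [hx, hy]
        simp only [map_add]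
        abel)
    (by intro a b; simp [hleft]) (by intro i a b; simp [hleft])
    (by intro i a; simp [hright, hoPauli_sq])
    (by intro i j a hij; simp [hright, hoPauli_mul i j hij])
  exact ho_step2 ⟨m, D, oneE, hcomm, h1, h2, h3, hone⟩ hfr
end
end
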